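/- Let n ≥ 2 and let Ω ⊂ ℝⁿ be a bounded set of finite perimeter. Then H^{n−1}(∂Ω ∩ Ω¹) = 0 if and only if for H^{n−1}-almost every x ∈ ∂Ω one has limsup_{r→0} |Ω ∩ B_r(x)|/|B_r(x)| < 1. -/

import Mathlib

open MeasureTheory Metric Filter Set
open scoped ENNReal Topology NNReal

noncomputable section

/-- The divergence of a vector field `φ : ℝⁿ → ℝⁿ`. -/
def vdiv {n : ℕ} (φ : EuclideanSpace ℝ (Fin n) → EuclideanSpace ℝ (Fin n))
    (x : EuclideanSpace ℝ (Fin n)) : ℝ :=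
  ∑ i, fderiv ℝ φ x (EuclideanSpace.single i 1) i

/-- The relative perimeter `P(E; W)` of a set `E` in an open set `W`, defined variationally as
`sup { ∫_E div φ : φ ∈ C¹_c(W; ℝⁿ), ‖φ‖_∞ ≤ 1 }`. -/
def relPerimeter {n : ℕ} (E W : Set (EuclideanSpace ℝ (Fin n))) : ℝ≥0∞ :=
  ⨆ (φ : EuclideanSpace ℝ (Fin n) → EuclideanSpace ℝ (Fin n)) (_ : ContDiff ℝ 1 φ)
    (_ : HasCompactSupport φ) (_ : tsupport φ ⊆ W) (_ : ∀ x, ‖φ x‖ ≤ 1),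
    ENNReal.ofReal (∫ x in E, vdiv φ x)

/-- The perimeter `P(E)` of a set `E ⊆ ℝⁿ`:
`P(E) = sup { ∫_E div φ : φ ∈ C¹_c(ℝⁿ; ℝⁿ), ‖φ‖_∞ ≤ 1 }`. -/
def perimeter {n : ℕ} (E : Set (EuclideanSpace ℝ (Fin n))) : ℝ≥0∞ :=
  relPerimeter E Set.univ

/-- The set of points where `Ω` has Lebesgue density `α`; `densityPts Ω 1` is the
measure-theoretic interior `Ω¹` and `densityPts Ω 0` is the measure-theoretic exterior `Ω⁰`. -/
def densityPts {n : ℕ} (Ω : Set (EuclideanSpace ℝ (Fin n))) (α : ℝ≥0∞) :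
    Set (EuclideanSpace ℝ (Fin n)) :=
  {x | Tendsto (fun r : ℝ => volume (Ω ∩ ball x r) / volume (ball x r)) (𝓝[>] 0) (𝓝 α)}

/-- A smooth set: a bounded open set whose topological boundary is a smooth hypersurface,
expressed via a smooth defining function with nonvanishing differential on the boundary. -/
def IsSmoothSet {n : ℕ} (E : Set (EuclideanSpace ℝ (Fin n))) : Prop :=
  IsOpen E ∧ Bornology.IsBounded E ∧
  ∃ f : EuclideanSpace ℝ (Fin n) → ℝ, ContDiff ℝ (⊤ : ℕ∞) f ∧
    E = {x | f x < 0} ∧ frontier E = {x | f x = 0} ∧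
    ∀ x ∈ frontier E, fderiv ℝ f x ≠ 0

/-- `E ⋐ Ω` : the closure of `E` is compact and contained in `Ω`. -/
def CpctContained {n : ℕ} (E Ω : Set (EuclideanSpace ℝ (Fin n))) : Prop :=
  IsCompact (closure E) ∧ closure E ⊆ Ω

/-- `E_k → Ω` in `L¹`, i.e. `|E_k Δ Ω| → 0`. -/
def TendstoL1 {n : ℕ} (E : ℕ → Set (EuclideanSpace ℝ (Fin n)))
    (Ω : Set (EuclideanSpace ℝ (Fin n))) : Prop :=
  Tendsto (fun k => volume ((E k \ Ω) ∪ (Ω \ E k))) atTop (𝓝 0)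

/-- The volume `ω_n` of the unit ball in ℝⁿ. -/
def unitBallVol (n : ℕ) : ℝ≥0∞ := volume (ball (0 : EuclideanSpace ℝ (Fin n)) 1)


open BoundedContinuousFunction in
/-- Positive part of a bounded functional. -/
def posPartFun {X : Type*} [TopologicalSpace X] (T : (X →ᵇ ℝ) →L[ℝ] ℝ) (F : X →ᵇ ℝ) : ℝ :=
  sSup (T '' {g | 0 ≤ g ∧ g ≤ F})

section riesz
open BoundedContinuousFunction
variable {X : Type*} [TopologicalSpace X] (T : (X →ᵇ ℝ) →L[ℝ] ℝ)

lemma posPartFun_bound_aux {F g : X →ᵇ ℝ} (h0 : 0 ≤ g) (h1 : g ≤ F) :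
    T g ≤ ‖T‖ * ‖F‖ := by
  refine (le_abs_self _).trans ((T.le_opNorm g).trans ?_)
  gcongr
  refine (BoundedContinuousFunction.norm_le (norm_nonneg _)).2 fun x => ?_
  have a : 0 ≤ g x := h0 x
  have b : g x ≤ F x := h1 x
  rw [Real.norm_of_nonneg a]
  exact b.trans ((le_abs_self _).trans (F.norm_coe_le_norm x))

lemma posPartFun_bdd (F : X →ᵇ ℝ) : BddAbove (T '' {g | 0 ≤ g ∧ g ≤ F}) :=
  ⟨‖T‖ * ‖F‖, by rintro _ ⟨g, ⟨h0, h1⟩, rfl⟩; exact posPartFun_bound_aux T h0 h1⟩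

lemma posPartFun_nonempty {F : X →ᵇ ℝ} (hF : 0 ≤ F) : (T '' {g | 0 ≤ g ∧ g ≤ F}).Nonempty :=
  ⟨T 0, 0, ⟨le_rfl, hF⟩, rfl⟩

lemma le_posPartFun {F g : X →ᵇ ℝ} (h0 : 0 ≤ g) (h1 : g ≤ F) : T g ≤ posPartFun T F :=
  le_csSup (posPartFun_bdd T F) ⟨g, ⟨h0, h1⟩, rfl⟩

lemma posPartFun_le {F : X →ᵇ ℝ} (hF : 0 ≤ F) {c : ℝ} (h : ∀ g, 0 ≤ g → g ≤ F → T g ≤ c) :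
    posPartFun T F ≤ c :=
  csSup_le (posPartFun_nonempty T hF) (by rintro _ ⟨g, ⟨h0, h1⟩, rfl⟩; exact h g h0 h1)

lemma posPartFun_nonneg {F : X →ᵇ ℝ} (hF : 0 ≤ F) : 0 ≤ posPartFun T F := by
  simpa using le_posPartFun T le_rfl hF

lemma posPartFun_bound {F : X →ᵇ ℝ} (hF : 0 ≤ F) : posPartFun T F ≤ ‖T‖ * ‖F‖ :=
  posPartFun_le T hF fun _ h0 h1 => posPartFun_bound_aux T h0 h1

lemma posPartFun_add {F G : X →ᵇ ℝ} (hF : 0 ≤ F) (hG : 0 ≤ G) :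
    posPartFun T (F + G) = posPartFun T F + posPartFun T G := by
  apply le_antisymm
  · refine posPartFun_le T (add_nonneg hF hG) fun g h0 h1 => ?_
    have h : g = g ⊓ F + (g - g ⊓ F) := by abel
    rw [h, map_add]
    refine add_le_add (le_posPartFun T (le_inf h0 hF) inf_le_right)
      (le_posPartFun T (sub_nonneg.2 inf_le_left) ?_)
    intro x
    have a : g x ≤ F x + G x := h1 x
    have b : 0 ≤ G x := hG x
    change g x - min (g x) (F x) ≤ G x
    rcases le_total (g x) (F x) with h | h
    · rw [inf_eq_left.2 h]; linarith
    · rw [inf_eq_right.2 h]; linarith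
  · rw [← le_sub_iff_add_le]
    refine posPartFun_le T hF fun g h0 h1 => ?_
    rw [le_sub_iff_add_le, ← le_sub_iff_add_le']
    refine posPartFun_le T hG fun g' h0' h1' => ?_
    rw [le_sub_iff_add_le', ← map_add]
    exact le_posPartFun T (add_nonneg h0 h0') (add_le_add h1 h1')

lemma posPartFun_smul {F : X →ᵇ ℝ} (hF : 0 ≤ F) {c : ℝ} (hc : 0 ≤ c) :
    posPartFun T (c • F) = c * posPartFun T F := by
  have key : ∀ (F : X →ᵇ ℝ) (c : ℝ), 0 ≤ F → 0 ≤ c → c * posPartFun T F ≤ posPartFun T (c • F) := by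
    intro F c hF hc
    rcases hc.eq_or_lt with rfl | hc
    · simpa using posPartFun_nonneg T (F := (0 : ℝ) • F) (by simp)
    rw [← le_div_iff₀' hc]
    refine posPartFun_le T hF fun g h0 h1 => ?_
    rw [le_div_iff₀' hc, ← smul_eq_mul, ← map_smul]
    refine le_posPartFun T ?_ ?_
    · intro x; simpa using mul_nonneg hc.le (h0 x)
    · intro x; simpa using mul_le_mul_of_nonneg_left (h1 x) hc.le
  apply le_antisymm _ (key F c hF hc)
  rcases hc.eq_or_lt with rfl | hc
  · have := posPartFun_bound T (F := (0 : ℝ) • F) (by simp)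
    simpa using this
  have h := key (c • F) c⁻¹ (by intro x; simpa using mul_nonneg hc.le (hF x)) (inv_nonneg.2 hc.le)
  rw [smul_smul, inv_mul_cancel₀ hc.ne', one_smul, inv_mul_le_iff₀ hc] at h
  exact h

lemma posPartFun_sub {F : X →ᵇ ℝ} (hF : 0 ≤ F) :
    posPartFun T F - posPartFun (-T) F = T F := by
  have key : ∀ (T : (X →ᵇ ℝ) →L[ℝ] ℝ), posPartFun T F ≤ T F + posPartFun (-T) F := by
    intro T
    refine posPartFun_le T hF fun g h0 h1 => ?_
    have := le_posPartFun (-T) (F := F) (sub_nonneg.2 h1) (by simpa using h0)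
    simp only [map_sub, _root_.neg_apply] at this
    linarith
  have h1 := key T
  have h2 := key (-T)
  have h3 : - -T = T := by ext; simp
  rw [h3] at h2
  simp only [_root_.neg_apply] at h2
  linarith

end riesz

section riesz2
open BoundedContinuousFunction CompactlySupported
variable {X : Type*} [TopologicalSpace X] [T2Space X] [LocallyCompactSpace X]
  [MeasurableSpace X] [BorelSpace X]

/-- A nonnegative compactly supported function as a bounded real function. -/
def ccToBdd {X : Type*} [TopologicalSpace X] (f : C_c(X, ℝ≥0)) : X →ᵇ ℝ :=
  BoundedContinuousFunction.ofNormedAddCommGroup (fun x => (f x : ℝ))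
    (NNReal.continuous_coe.comp f.continuous)
    (Classical.choose (HasCompactSupport.exists_bound_of_continuous
      (f := fun x => (f x : ℝ)) (f.hasCompactSupport.comp_left (g := fun t : ℝ≥0 => (t : ℝ)) rfl)
      (NNReal.continuous_coe.comp f.continuous)))
    (Classical.choose_spec (HasCompactSupport.exists_bound_of_continuous
      (f := fun x => (f x : ℝ)) (f.hasCompactSupport.comp_left (g := fun t : ℝ≥0 => (t : ℝ)) rfl)
      (NNReal.continuous_coe.comp f.continuous)))

lemma ccToBdd_apply {X : Type*} [TopologicalSpace X] (f : C_c(X, ℝ≥0)) (x : X) :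
    ccToBdd f x = f x := rfl

lemma ccToBdd_nonneg {X : Type*} [TopologicalSpace X] (f : C_c(X, ℝ≥0)) : 0 ≤ ccToBdd f :=
  fun x => (f x).2

/-- The positive part as a linear functional. -/
def posLin {X : Type*} [TopologicalSpace X] (T : (X →ᵇ ℝ) →L[ℝ] ℝ) :
    C_c(X, ℝ≥0) →ₗ[ℝ≥0] ℝ≥0 where
  toFun f := ⟨posPartFun T (ccToBdd f), posPartFun_nonneg T (ccToBdd_nonneg f)⟩
  map_add' f g := by
    apply NNReal.eq
    have : ccToBdd (f + g) = ccToBdd f + ccToBdd g := by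
      ext x; simp [ccToBdd_apply]
    simp only [this, posPartFun_add T (ccToBdd_nonneg f) (ccToBdd_nonneg g)]
    rfl
  map_smul' c f := by
    apply NNReal.eq
    have : ccToBdd (c • f) = (c : ℝ) • ccToBdd f := by
      ext x; simp [ccToBdd_apply]
    change posPartFun T (ccToBdd (c • f)) = (c : ℝ) * posPartFun T (ccToBdd f)
    rw [this, posPartFun_smul T (ccToBdd_nonneg f) c.coe_nonneg]

lemma posLin_coe {X : Type*} [TopologicalSpace X] (T : (X →ᵇ ℝ) →L[ℝ] ℝ) (f : C_c(X, ℝ≥0)) :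
    (posLin T f : ℝ) = posPartFun T (ccToBdd f) := rfl

lemma finite_rieszMeasure_posLin (T : (X →ᵇ ℝ) →L[ℝ] ℝ) :
    IsFiniteMeasure (NNRealRMK.rieszMeasure (posLin T)) := by
  refine ⟨lt_of_le_of_lt ?_ (ENNReal.ofReal_lt_top (r := ‖T‖))⟩
  rw [isOpen_univ.measure_eq_iSup_isCompact]
  refine iSup₂_le fun K _ => iSup_le fun hK => ?_
  obtain ⟨f, hf1, -, hf2, hf3⟩ := exists_continuous_one_zero_of_isCompact hK isClosed_empty
    (disjoint_empty K)
  let g : C_c(X, ℝ≥0) := ⟨⟨fun x => (f x).toNNReal, by fun_prop⟩,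
    hf2.comp_left (g := Real.toNNReal) (by simp)⟩
  have h1 : NNRealRMK.rieszMeasure (posLin T) K ≤ ∫⁻ x, g x ∂(NNRealRMK.rieszMeasure (posLin T)) := by
    calc NNRealRMK.rieszMeasure (posLin T) K
        = ∫⁻ x in K, 1 ∂(NNRealRMK.rieszMeasure (posLin T)) := by simp
      _ ≤ ∫⁻ x in K, g x ∂(NNRealRMK.rieszMeasure (posLin T)) := by
          refine setLIntegral_mono' hK.measurableSet fun x hx => ?_
          have : g x = (f x).toNNReal := rfl
          rw [this, hf1 hx]; simp
      _ ≤ _ := setLIntegral_le_lintegral _ _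
  refine h1.trans ?_
  rw [NNRealRMK.lintegral_rieszMeasure]
  rw [← ENNReal.ofReal_coe_nnreal, posLin_coe]
  apply ENNReal.ofReal_le_ofReal
  refine (posPartFun_bound T (ccToBdd_nonneg g)).trans ?_
  refine mul_le_of_le_one_right T.opNorm_nonneg ?_
  refine (BoundedContinuousFunction.norm_le zero_le_one).2 fun x => ?_
  change ‖((f x).toNNReal : ℝ)‖ ≤ 1
  rw [Real.coe_toNNReal _ (hf3 x).1, Real.norm_of_nonneg (hf3 x).1]
  exact (hf3 x).2

theorem riesz_bdd (T : (X →ᵇ ℝ) →L[ℝ] ℝ) : ∃ μp μm : Measure X, IsFiniteMeasure μp ∧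
    IsFiniteMeasure μm ∧ ∀ f : X →ᵇ ℝ, HasCompactSupport f →
      T f = ∫ x, f x ∂μp - ∫ x, f x ∂μm := by
  refine ⟨NNRealRMK.rieszMeasure (posLin T), NNRealRMK.rieszMeasure (posLin (-T)),
    finite_rieszMeasure_posLin T, finite_rieszMeasure_posLin (-T), fun f hf => ?_⟩
  have := finite_rieszMeasure_posLin T
  have := finite_rieszMeasure_posLin (-T)
  have key : ∀ g : C_c(X, ℝ≥0), T (ccToBdd g) = ∫ x, (g x : ℝ) ∂NNRealRMK.rieszMeasure (posLin T)
      - ∫ x, (g x : ℝ) ∂NNRealRMK.rieszMeasure (posLin (-T)) := by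
    intro g
    rw [NNRealRMK.integral_rieszMeasure, NNRealRMK.integral_rieszMeasure, posLin_coe, posLin_coe,
      posPartFun_sub T (ccToBdd_nonneg g)]
  let gp : C_c(X, ℝ≥0) := ⟨⟨fun x => (f x).toNNReal, by fun_prop⟩,
    hf.comp_left (g := Real.toNNReal) (by simp)⟩
  let gm : C_c(X, ℝ≥0) := ⟨⟨fun x => (-f x).toNNReal, by fun_prop⟩,
    hf.comp_left (g := fun t => Real.toNNReal (-t)) (by simp)⟩
  have h : f = ccToBdd gp - ccToBdd gm := by
    ext x
    change f x = ((f x).toNNReal : ℝ) - ((-f x).toNNReal : ℝ)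
    simp only [Real.coe_toNNReal']
    rcases le_total (f x) 0 with h | h
    · rw [max_eq_right h, max_eq_left (by linarith)]; ring
    · rw [max_eq_left h, max_eq_right (by linarith)]; ring
  have hi : ∀ (g : X →ᵇ ℝ) (μ : Measure X) [IsFiniteMeasure μ], Integrable (fun x => g x) μ :=
    fun g μ _ => g.integrable μ
  have e : ∀ μ : Measure X, IsFiniteMeasure μ → ∫ x, f x ∂μ = ∫ x, (gp x : ℝ) ∂μ - ∫ x, (gm x : ℝ) ∂μ := by
    intro μ hμ
    have e1 := integral_sub (hi (ccToBdd gp) μ) (hi (ccToBdd gm) μ)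
    refine Eq.trans ?_ e1
    congr 1
    ext x
    conv_lhs => rw [h]
    rfl
  conv_lhs => rw [h]
  rw [map_sub, key, key, e _ inferInstance, e _ inferInstance]
  ring
end riesz2

section gg
open BoundedContinuousFunction

lemma vdiv_smul_single {n : ℕ} {ψ : EuclideanSpace ℝ (Fin n) → ℝ} (hψ : ContDiff ℝ 1 ψ)
    (i : Fin n) (x : EuclideanSpace ℝ (Fin n)) :
    vdiv (fun y => ψ y • (EuclideanSpace.single i (1 : ℝ) : EuclideanSpace ℝ (Fin n))) x =
      fderiv ℝ ψ x (EuclideanSpace.single i 1) := by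
  unfold vdiv
  have hd : DifferentiableAt ℝ ψ x := (hψ.differentiable one_ne_zero) x
  rw [fderiv_smul_const hd]
  simp only [ContinuousLinearMap.smulRight_apply, PiLp.smul_apply, smul_eq_mul]
  rw [Finset.sum_eq_single i]
  · simp
  · intro j _ hj
    simp [hj]
  · simp

lemma integrable_fderiv_apply {n : ℕ} {ψ : EuclideanSpace ℝ (Fin n) → ℝ} (hψ : ContDiff ℝ 1 ψ)
    (hc : HasCompactSupport ψ) (v : EuclideanSpace ℝ (Fin n)) :
    Integrable (fun x => fderiv ℝ ψ x v) := by
  refine Continuous.integrable_of_hasCompactSupport ?_ (hc.fderiv_apply ℝ v)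
  exact (hψ.continuous_fderiv one_ne_zero).clm_apply continuous_const

lemma perimeter_bound {n : ℕ} {Ω : Set (EuclideanSpace ℝ (Fin n))} (hper : perimeter Ω ≠ ⊤)
    {ψ : EuclideanSpace ℝ (Fin n) → ℝ} (hψ : ContDiff ℝ 1 ψ)
    (hc : HasCompactSupport ψ) (i : Fin n) {M : ℝ} (hM : ∀ x, |ψ x| ≤ M) :
    |∫ x in Ω, fderiv ℝ ψ x (EuclideanSpace.single i 1)| ≤ (perimeter Ω).toReal * M := by
  have key1 : ∀ {ψ : EuclideanSpace ℝ (Fin n) → ℝ}, ContDiff ℝ 1 ψ → HasCompactSupport ψ →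
      (∀ x, |ψ x| ≤ 1) →
      ∫ x in Ω, fderiv ℝ ψ x (EuclideanSpace.single i 1) ≤ (perimeter Ω).toReal := by
    intro ψ hψ hc h1
    rw [← ENNReal.ofReal_le_iff_le_toReal hper]
    have := le_iSup₂_of_le (f := fun (φ : EuclideanSpace ℝ (Fin n) → EuclideanSpace ℝ (Fin n))
      (_ : ContDiff ℝ 1 φ) => ⨆ (_ : HasCompactSupport φ) (_ : tsupport φ ⊆ univ)
      (_ : ∀ x, ‖φ x‖ ≤ 1), ENNReal.ofReal (∫ x in Ω, vdiv φ x))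
      (fun y => ψ y • (EuclideanSpace.single i (1 : ℝ) : EuclideanSpace ℝ (Fin n)))
      (hψ.smul contDiff_const) (le_iSup_of_le hc.smul_right (le_iSup₂_of_le (subset_univ _)
        (fun x => by simpa [norm_smul] using h1 x) le_rfl))
    simp only [vdiv_smul_single hψ] at this
    exact this
  have key2 : ∀ {ψ : EuclideanSpace ℝ (Fin n) → ℝ}, ContDiff ℝ 1 ψ → HasCompactSupport ψ →
      ∀ {M : ℝ}, 0 < M → (∀ x, |ψ x| ≤ M) →
      |∫ x in Ω, fderiv ℝ ψ x (EuclideanSpace.single i 1)| ≤ (perimeter Ω).toReal * M := by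
    intro ψ hψ hc M hM h1
    have h : ∀ c : ℝ, |c| = M⁻¹ → c * ∫ x in Ω, fderiv ℝ ψ x (EuclideanSpace.single i 1) ≤
        (perimeter Ω).toReal := by
      intro c hcM
      have := key1 (ψ := fun x => c * ψ x) (contDiff_const.mul hψ) hc.mul_left (fun x => by
        rw [abs_mul, hcM, inv_mul_le_iff₀ hM]; simpa using h1 x)
      refine le_of_eq_of_le ?_ this
      rw [← integral_const_mul]
      congr 1
      ext x
      rw [fderiv_const_mul ((hψ.differentiable one_ne_zero) x)]
      rfl
    rw [abs_le]
    have a := h M⁻¹ (abs_of_pos (inv_pos.2 hM))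
    have b := h (-M⁻¹) (by rw [abs_neg]; exact abs_of_pos (inv_pos.2 hM))
    rw [inv_mul_le_iff₀ hM] at a
    rw [neg_mul, ← mul_neg, inv_mul_le_iff₀ hM] at b
    constructor <;> linarith
  have hM0 : 0 ≤ M := (abs_nonneg _).trans (hM 0)
  refine le_of_forall_pos_le_add fun ε hε => ?_
  have hP : 0 ≤ (perimeter Ω).toReal := ENNReal.toReal_nonneg
  have := key2 hψ hc (M := M + ε / ((perimeter Ω).toReal + 1)) (by positivity)
    (fun x => (hM x).trans (le_add_of_nonneg_right (by positivity)))
  refine this.trans ?_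
  rw [mul_add]
  gcongr
  rw [← mul_div_assoc, div_le_iff₀ (by positivity)]
  nlinarith

/-- Space of `C¹` compactly supported functions. -/
def c1c (n : ℕ) : Submodule ℝ (EuclideanSpace ℝ (Fin n) →ᵇ ℝ) where
  carrier := {ψ | ContDiff ℝ 1 ψ ∧ HasCompactSupport ψ}
  zero_mem' := ⟨contDiff_const, HasCompactSupport.zero⟩
  add_mem' := fun ha hb => ⟨ha.1.add hb.1, ha.2.add hb.2⟩
  smul_mem' := fun c _ ha => ⟨contDiff_const.smul ha.1, ha.2.smul_left (f := fun _ => c)⟩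

lemma exists_functional {n : ℕ} {Ω : Set (EuclideanSpace ℝ (Fin n))} (hper : perimeter Ω ≠ ⊤)
    (i : Fin n) : ∃ T : (EuclideanSpace ℝ (Fin n) →ᵇ ℝ) →L[ℝ] ℝ,
      ∀ ψ : EuclideanSpace ℝ (Fin n) →ᵇ ℝ, ContDiff ℝ 1 ψ → HasCompactSupport ψ →
        T ψ = ∫ x in Ω, fderiv ℝ ψ x (EuclideanSpace.single i 1) := by
  let f : c1c n →ₗ[ℝ] ℝ :=
    { toFun := fun ψ => ∫ x in Ω, fderiv ℝ (ψ : EuclideanSpace ℝ (Fin n) →ᵇ ℝ) x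
        (EuclideanSpace.single i 1)
      map_add' := by
        intro a b
        rw [← integral_add (integrable_fderiv_apply a.2.1 a.2.2 _).integrableOn
          (integrable_fderiv_apply b.2.1 b.2.2 _).integrableOn]
        congr 1
        ext x
        have := fderiv_add ((a.2.1.differentiable one_ne_zero) x)
          ((b.2.1.differentiable one_ne_zero) x)
        exact congrArg (fun L => L (EuclideanSpace.single i 1)) this
      map_smul' := by
        intro c a
        simp only [RingHom.id_apply, smul_eq_mul]
        rw [← integral_const_mul]
        congr 1
        ext x
        have := fderiv_const_smul ((a.2.1.differentiable one_ne_zero) x) c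
        exact congrArg (fun L => L (EuclideanSpace.single i 1)) this }
  have hF : ∀ ψ : c1c n, ‖f ψ‖ ≤ (perimeter Ω).toReal * ‖ψ‖ := fun ψ =>
    perimeter_bound hper ψ.2.1 ψ.2.2 i (fun x => ψ.1.norm_coe_le_norm x)
  let F : StrongDual ℝ (c1c n) := ⟨f, AddMonoidHomClass.continuous_of_bound f _ hF⟩
  obtain ⟨T, hT, -⟩ := exists_extension_norm_eq (c1c n) F
  exact ⟨T, fun ψ h1 h2 => hT ⟨ψ, h1, h2⟩⟩

theorem gauss_green {n : ℕ} {Ω : Set (EuclideanSpace ℝ (Fin n))} (hper : perimeter Ω ≠ ⊤) :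
    ∃ (μ : Measure (EuclideanSpace ℝ (Fin n)))
      (ν : EuclideanSpace ℝ (Fin n) → EuclideanSpace ℝ (Fin n)),
      IsFiniteMeasure μ ∧ Measurable ν ∧ (∀ i, ∀ᵐ x ∂μ, |ν x i| ≤ 1) ∧ (∀ᵐ x ∂μ, ν x ≠ 0) ∧
      ∀ ψ : EuclideanSpace ℝ (Fin n) → ℝ, ContDiff ℝ 1 ψ → HasCompactSupport ψ → ∀ i,
        ∫ x in Ω, fderiv ℝ ψ x (EuclideanSpace.single i 1) = ∫ x, ψ x * ν x i ∂μ := by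
  choose T hT using fun i => exists_functional hper i
  choose μp μm hp hm hpm using fun i => riesz_bdd (T i)
  have : ∀ i, IsFiniteMeasure (μp i) := hp
  have : ∀ i, IsFiniteMeasure (μm i) := hm
  obtain ⟨μ, hfin, hle⟩ : ∃ μ : Measure (EuclideanSpace ℝ (Fin n)), IsFiniteMeasure μ ∧
      ∀ i, μp i + μm i ≤ μ := by
    refine ⟨∑ i, (μp i + μm i), inferInstance, fun i => ?_⟩
    refine Measure.le_iff.2 fun s _ => ?_
    simp only [Measure.finsetSum_apply]
    exact Finset.single_le_sum (f := fun i => (μp i + μm i) s) (fun _ _ => zero_le)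
      (Finset.mem_univ i)
  have hlep : ∀ i, μp i ≤ μ := fun i => (Measure.le_add_right le_rfl).trans (hle i)
  have hlem : ∀ i, μm i ≤ μ := fun i => (Measure.le_add_left le_rfl).trans (hle i)
  let ν : EuclideanSpace ℝ (Fin n) → EuclideanSpace ℝ (Fin n) := fun x => WithLp.toLp 2
    (fun i => ((μp i).rnDeriv μ x).toReal - ((μm i).rnDeriv μ x).toReal)
  have hνi : ∀ x i, ν x i = ((μp i).rnDeriv μ x).toReal - ((μm i).rnDeriv μ x).toReal :=
    fun _ _ => rfl
  have hν : Measurable ν := by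
    apply (WithLp.measurable_toLp 2 _).comp
    refine measurable_pi_lambda _ fun i => ?_
    exact ((μp i).measurable_rnDeriv μ).ennreal_toReal.sub ((μm i).measurable_rnDeriv μ).ennreal_toReal
  have hS : MeasurableSet {x | ν x ≠ 0} := (measurableSet_eq_fun hν measurable_const).compl
  have hb : ∀ i, ∀ᵐ x ∂μ, |ν x i| ≤ 1 := by
    intro i
    filter_upwards [Measure.rnDeriv_le_one_of_le (hlep i), Measure.rnDeriv_le_one_of_le (hlem i)]
      with x h1 h2
    rw [hνi]
    have a1 := ENNReal.toReal_mono ENNReal.one_ne_top h1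
    have a2 := ENNReal.toReal_mono ENNReal.one_ne_top h2
    simp only [ENNReal.toReal_one] at a1 a2
    have b1 : 0 ≤ ((μp i).rnDeriv μ x).toReal := ENNReal.toReal_nonneg
    have b2 : 0 ≤ ((μm i).rnDeriv μ x).toReal := ENNReal.toReal_nonneg
    rw [abs_le]; constructor <;> linarith
  refine ⟨μ.restrict {x | ν x ≠ 0}, ν, inferInstance, hν, fun i => ae_restrict_of_ae (hb i),
    ae_restrict_mem hS, ?_⟩
  intro ψ h1 h2 i
  obtain ⟨C, hC⟩ := h2.exists_bound_of_continuous h1.continuous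
  let ψb : EuclideanSpace ℝ (Fin n) →ᵇ ℝ :=
    BoundedContinuousFunction.ofNormedAddCommGroup ψ h1.continuous C hC
  have e1 := hT i ψb h1 h2
  rw [hpm i ψb h2] at e1
  change _ = ∫ x in Ω, fderiv ℝ ψ x (EuclideanSpace.single i 1) at e1
  rw [← e1]
  change ∫ x, ψ x ∂μp i - ∫ x, ψ x ∂μm i = _
  have e2 : ∫ x in {x | ν x ≠ 0}, ψ x * ν x i ∂μ = ∫ x, ψ x * ν x i ∂μ := by
    apply setIntegral_eq_integral_of_forall_compl_eq_zero
    intro x hx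
    have : ν x = 0 := by simpa using hx
    rw [this]; simp
  have := Measure.haveLebesgueDecomposition_of_sigmaFinite (μp i) μ
  have := Measure.haveLebesgueDecomposition_of_sigmaFinite (μm i) μ
  rw [e2, ← integral_rnDeriv_smul (hlep i).absolutelyContinuous,
    ← integral_rnDeriv_smul (hlem i).absolutelyContinuous, ← integral_sub]
  · congr 1
    ext x
    rw [hνi]; simp only [smul_eq_mul]; ring
  · exact (integrable_rnDeriv_smul_iff (hlep i).absolutelyContinuous).2
      (ψb.integrable (μp i))
  · exact (integrable_rnDeriv_smul_iff (hlem i).absolutelyContinuous).2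
      (ψb.integrable (μm i))
end gg

section sobolev
open ContinuousLinearMap Convolution

lemma enorm_clm_le {n : ℕ} (L : EuclideanSpace ℝ (Fin n) →L[ℝ] ℝ) :
    ‖L‖ₑ ≤ ∑ i, ‖L (EuclideanSpace.single i 1)‖ₑ := by
  have h : ‖L‖ ≤ ∑ i, ‖L (EuclideanSpace.single i 1)‖ := by
    refine L.opNorm_le_bound (Finset.sum_nonneg fun _ _ => norm_nonneg _) fun v => ?_
    have hv : v = ∑ i, v i • (EuclideanSpace.single i (1 : ℝ) : EuclideanSpace ℝ (Fin n)) := by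
      ext j
      simp [Finset.sum_apply, Pi.single_apply]
    conv_lhs => rw [hv]
    rw [map_sum, Finset.sum_mul]
    refine (norm_sum_le _ _).trans (Finset.sum_le_sum fun i _ => ?_)
    rw [map_smul, norm_smul, mul_comm]
    gcongr
    exact PiLp.norm_apply_le v i
  rw [← ofReal_norm]
  refine (ENNReal.ofReal_le_ofReal h).trans ?_
  rw [ENNReal.ofReal_sum_of_nonneg (fun _ _ => norm_nonneg _)]
  simp only [ofReal_norm, le_refl]

lemma mollify_bound {n : ℕ} {u : EuclideanSpace ℝ (Fin n) → ℝ}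
    (hu : LocallyIntegrable u)
    {κ : Measure (EuclideanSpace ℝ (Fin n))} [IsFiniteMeasure κ]
    (h : ∀ ψ : EuclideanSpace ℝ (Fin n) → ℝ, ContDiff ℝ 1 ψ → HasCompactSupport ψ → ∀ i,
      |∫ x, u x * fderiv ℝ ψ x (EuclideanSpace.single i 1)| ≤ ∫ x, |ψ x| ∂κ)
    (φ : ContDiffBump (0 : EuclideanSpace ℝ (Fin n))) :
    ∫⁻ x, ‖fderiv ℝ (φ.normed volume ⋆[lsmul ℝ ℝ, volume] u) x‖ₑ ≤ n * κ univ := by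
  set ρ := φ.normed volume with hρ
  have hρc : ContDiff ℝ 1 ρ := φ.contDiff_normed (n := 1)
  have hρs : HasCompactSupport ρ := φ.hasCompactSupport_normed
  have hρ0 : ∀ x, 0 ≤ ρ x := φ.nonneg_normed
  have hpt : ∀ z i, ‖fderiv ℝ (ρ ⋆[lsmul ℝ ℝ, volume] u) z (EuclideanSpace.single i 1)‖ₑ ≤
      ∫⁻ t, ENNReal.ofReal (ρ (z - t)) ∂κ := by
    intro z i
    have hψc : ContDiff ℝ 1 (fun t => ρ (z - t)) := hρc.comp (contDiff_const.sub contDiff_id)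
    have hψs : HasCompactSupport (fun t => ρ (z - t)) :=
      hρs.comp_homeomorph (Homeomorph.subLeft z)
    have e1 : fderiv ℝ (ρ ⋆[lsmul ℝ ℝ, volume] u) z (EuclideanSpace.single i 1) =
        ∫ t, u t * fderiv ℝ ρ (z - t) (EuclideanSpace.single i 1) := by
      rw [← convolution_flip, (hρs.hasFDerivAt_convolution_right _ hu hρc z).fderiv,
        convolution_precompR_apply _ hu (hρs.fderiv ℝ) (hρc.continuous_fderiv one_ne_zero),
        convolution_def]
      congr 1
      ext t
      simp [mul_comm]
    have e2 : ∀ t, fderiv ℝ (fun t => ρ (z - t)) t (EuclideanSpace.single i 1) =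
        - fderiv ℝ ρ (z - t) (EuclideanSpace.single i 1) := by
      intro t
      have h1 : HasFDerivAt (fun t => z - t) (-ContinuousLinearMap.id ℝ (EuclideanSpace ℝ (Fin n))) t := by
        simpa using (hasFDerivAt_id t).const_sub z
      have h2 := ((hρc.differentiable one_ne_zero) (z - t)).hasFDerivAt.comp t h1
      have h3 : HasFDerivAt (fun t => ρ (z - t)) _ t := h2
      rw [h3.fderiv]
      simp
    have e3 := h _ hψc hψs i
    simp only [e2, mul_neg, integral_neg, abs_neg] at e3
    rw [e1, ← ofReal_norm, Real.norm_eq_abs]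
    refine (ENNReal.ofReal_le_ofReal e3).trans ?_
    rw [ofReal_integral_eq_lintegral_ofReal
      (Continuous.integrable_of_hasCompactSupport hψc.continuous.abs hψs.abs)
      (Eventually.of_forall fun _ => abs_nonneg _)]
    simp only [abs_of_nonneg (hρ0 _), le_refl]
  have hm : Measurable (fun q : EuclideanSpace ℝ (Fin n) × EuclideanSpace ℝ (Fin n) =>
      ENNReal.ofReal (ρ (q.1 - q.2))) := by
    exact (ENNReal.continuous_ofReal.comp
      (hρc.continuous.comp (continuous_fst.sub continuous_snd))).measurable
  have hone : ∀ t, ∫⁻ z, ENNReal.ofReal (ρ (z - t)) = 1 := by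
    intro t
    rw [lintegral_sub_right_eq_self (fun z => ENNReal.ofReal (ρ z)) t,
      ← ofReal_integral_eq_lintegral_ofReal φ.integrable_normed (Eventually.of_forall hρ0),
      φ.integral_normed]
    simp
  calc ∫⁻ x, ‖fderiv ℝ (ρ ⋆[lsmul ℝ ℝ, volume] u) x‖ₑ
      ≤ ∫⁻ z, n * ∫⁻ t, ENNReal.ofReal (ρ (z - t)) ∂κ := by
        refine lintegral_mono fun z => (enorm_clm_le _).trans ?_
        refine (Finset.sum_le_sum fun i _ => hpt z i).trans ?_
        simp
    _ = n * ∫⁻ z, ∫⁻ t, ENNReal.ofReal (ρ (z - t)) ∂κ := by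
        rw [lintegral_const_mul]
        exact hm.lintegral_prod_right'
    _ = n * κ univ := by
        rw [lintegral_lintegral_swap hm.aemeasurable]
        simp [hone]

theorem bv_sobolev {n : ℕ} (hn : 2 ≤ n) : ∃ C : ℝ≥0, ∀ u : EuclideanSpace ℝ (Fin n) → ℝ,
    LocallyIntegrable u → HasCompactSupport u → ∀ κ : Measure (EuclideanSpace ℝ (Fin n)),
    IsFiniteMeasure κ →
    (∀ ψ : EuclideanSpace ℝ (Fin n) → ℝ, ContDiff ℝ 1 ψ → HasCompactSupport ψ → ∀ i,
      |∫ x, u x * fderiv ℝ ψ x (EuclideanSpace.single i 1)| ≤ ∫ x, |ψ x| ∂κ) →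
    ∫⁻ x, ‖u x‖ₑ ^ (Real.conjExponent n) ≤ C * κ univ ^ (Real.conjExponent n) := by
  have hp : Real.HolderConjugate (Module.finrank ℝ (EuclideanSpace ℝ (Fin n))) (Real.conjExponent n) := by
    rw [finrank_euclideanSpace_fin]
    exact Real.HolderConjugate.conjExponent (by exact_mod_cast hn)
  set p := Real.conjExponent n with hpdef
  have hp0 : 0 ≤ p := hp.symm.pos.le
  refine ⟨lintegralPowLePowLIntegralFDerivConst
    (volume : Measure (EuclideanSpace ℝ (Fin n))) p * (n : ℝ≥0) ^ p, ?_⟩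
  intro u hu hus κ hκ h
  let φ : ℕ → ContDiffBump (0 : EuclideanSpace ℝ (Fin n)) := fun k =>
    ⟨1 / ((k : ℝ) + 1), 2 / ((k : ℝ) + 1), by positivity, by gcongr; norm_num⟩
  let w : ℕ → EuclideanSpace ℝ (Fin n) → ℝ := fun k =>
    (φ k).normed volume ⋆[lsmul ℝ ℝ, volume] u
  have hlim : ∀ᵐ x, Tendsto (fun k => w k x) atTop (𝓝 (u x)) := by
    refine ContDiffBump.ae_convolution_tendsto_right_of_locallyIntegrable (K := 2) ?_ ?_ hu
    · have h0 := (tendsto_one_div_add_atTop_nhds_zero_nat (𝕜 := ℝ)).const_mul 2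
      simp only [mul_one_div, mul_zero] at h0
      exact h0
    · refine Eventually.of_forall fun k => ?_
      change 2 / ((k : ℝ) + 1) ≤ 2 * (1 / ((k : ℝ) + 1))
      rw [mul_one_div]
  have hwc : ∀ k, ContDiff ℝ 1 (w k) := fun k =>
    ((φ k).hasCompactSupport_normed).contDiff_convolution_left (n := 1) _ (φ k).contDiff_normed hu
  have hws : ∀ k, HasCompactSupport (w k) := fun k =>
    ((φ k).hasCompactSupport_normed).convolution _ hus
  have hbd : ∀ k, ∫⁻ x, ‖w k x‖ₑ ^ p ≤ (lintegralPowLePowLIntegralFDerivConst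
    (volume : Measure (EuclideanSpace ℝ (Fin n))) p * (n : ℝ≥0) ^ p : ℝ≥0) * κ univ ^ p := by
    intro k
    refine (lintegral_pow_le_pow_lintegral_fderiv volume (hwc k) (hws k) hp).trans ?_
    rw [ENNReal.coe_mul, mul_assoc]
    gcongr
    refine (ENNReal.rpow_le_rpow (mollify_bound hu h (φ k)) hp0).trans ?_
    rw [ENNReal.mul_rpow_of_nonneg _ _ hp0, ENNReal.coe_rpow_of_nonneg _ hp0]
    simp
  calc ∫⁻ x, ‖u x‖ₑ ^ p ≤ ∫⁻ x, liminf (fun k => ‖w k x‖ₑ ^ p) atTop := by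
        refine lintegral_mono_ae ?_
        filter_upwards [hlim] with x hx
        have : Tendsto (fun k => ‖w k x‖ₑ ^ p) atTop (𝓝 (‖u x‖ₑ ^ p)) :=
          (ENNReal.continuous_rpow_const.tendsto _).comp hx.enorm
        rw [this.liminf_eq]
    _ ≤ liminf (fun k => ∫⁻ x, ‖w k x‖ₑ ^ p) atTop := by
        refine lintegral_liminf_le fun k => ?_
        have := (hwc k).continuous.measurable
        fun_prop
    _ ≤ _ := by
        refine liminf_le_of_le (by isBoundedDefault) fun b hb => ?_
        obtain ⟨k, hk⟩ := hb.exists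
        exact hk.trans (hbd k)
end sobolev

section cutoff

lemma hasDerivAt_posSq (s : ℝ) : HasDerivAt (fun s : ℝ => (max 0 s) ^ 2) (2 * max 0 s) s := by
  rcases lt_trichotomy s 0 with h | h | h
  · rw [max_eq_left h.le, mul_zero]
    refine (hasDerivAt_const s (0 : ℝ)).congr_of_eventuallyEq ?_
    filter_upwards [Iio_mem_nhds h] with t ht
    rw [max_eq_left (le_of_lt ht)]; norm_num
  · subst h
    rw [max_self, mul_zero, hasDerivAt_iff_isLittleO]
    have h1 : (fun x : ℝ => x ^ 2) =o[𝓝 0] fun x : ℝ => x := by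
      simpa using Asymptotics.isLittleO_pow_id (𝕜 := ℝ) (n := 2) (by norm_num)
    have h2 : (fun x : ℝ => max 0 x ^ 2) =O[𝓝 0] fun x : ℝ => x ^ 2 := by
      refine Asymptotics.IsBigO.of_bound 1 (Eventually.of_forall fun x => ?_)
      rw [one_mul, Real.norm_eq_abs, Real.norm_eq_abs, abs_of_nonneg (by positivity),
        abs_of_nonneg (by positivity), sq_le_sq, abs_of_nonneg (le_max_left _ _)]
      exact max_le (abs_nonneg _) (le_abs_self _)
    simpa using h2.trans_isLittleO h1
  · rw [max_eq_right h.le]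
    have : HasDerivAt (fun s : ℝ => s ^ 2) (2 * s) s := by simpa using hasDerivAt_pow 2 s
    refine this.congr_of_eventuallyEq ?_
    filter_upwards [Ioi_mem_nhds h] with t ht
    rw [max_eq_right (le_of_lt ht)]

lemma contDiff_posSq : ContDiff ℝ 1 (fun s : ℝ => (max 0 s) ^ 2) := by
  rw [contDiff_one_iff_deriv]
  refine ⟨fun s => (hasDerivAt_posSq s).differentiableAt, ?_⟩
  have : deriv (fun s : ℝ => (max 0 s) ^ 2) = fun s => 2 * max 0 s :=
    funext fun s => (hasDerivAt_posSq s).deriv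
  rw [this]
  fun_prop

/-- A `C¹` radial cutoff. -/
def cut {n : ℕ} (x : EuclideanSpace ℝ (Fin n)) (R : ℝ) (y : EuclideanSpace ℝ (Fin n)) : ℝ :=
  (max 0 (1 - ‖y - x‖ ^ 2 / R ^ 2)) ^ 2

variable {n : ℕ} (x : EuclideanSpace ℝ (Fin n)) {R : ℝ}

lemma cut_contDiff : ContDiff ℝ 1 (cut x R) := by
  have h : ContDiff ℝ 1 (fun y : EuclideanSpace ℝ (Fin n) => 1 - ‖y - x‖ ^ 2 / R ^ 2) :=
    contDiff_const.sub (((contDiff_id.sub contDiff_const).norm_sq ℝ).div_const _)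
  exact contDiff_posSq.comp h

lemma cut_nonneg (y : EuclideanSpace ℝ (Fin n)) : 0 ≤ cut x R y := by
  unfold cut; positivity

lemma cut_le_one (y : EuclideanSpace ℝ (Fin n)) : cut x R y ≤ 1 := by
  unfold cut
  refine pow_le_one₀ (le_max_left _ _) (max_le zero_le_one ?_)
  have : 0 ≤ ‖y - x‖ ^ 2 / R ^ 2 := by positivity
  linarith

lemma cut_eq_zero (hR : 0 < R) {y : EuclideanSpace ℝ (Fin n)} (hy : y ∉ ball x R) :
    max 0 (1 - ‖y - x‖ ^ 2 / R ^ 2) = 0 := by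
  rw [mem_ball, dist_eq_norm, not_lt] at hy
  refine max_eq_left ?_
  have : 1 ≤ ‖y - x‖ ^ 2 / R ^ 2 := by
    rw [one_le_div (by positivity)]; gcongr
  linarith

lemma cut_compact (hR : 0 < R) : HasCompactSupport (cut x R) := by
  refine HasCompactSupport.intro (isCompact_closedBall x R) fun y hy => ?_
  unfold cut
  rw [cut_eq_zero x hR (fun h => hy (ball_subset_closedBall h))]; norm_num

lemma cut_ge (hR : 0 < R) {y : EuclideanSpace ℝ (Fin n)} (hy : y ∈ ball x (R / 2)) :
    9 / 16 ≤ cut x R y := by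
  rw [mem_ball, dist_eq_norm] at hy
  have h1 : ‖y - x‖ ^ 2 / R ^ 2 ≤ 1 / 4 := by
    rw [div_le_iff₀ (by positivity)]
    have := norm_nonneg (y - x)
    nlinarith
  unfold cut
  have h2 : 3 / 4 ≤ max 0 (1 - ‖y - x‖ ^ 2 / R ^ 2) := le_max_of_le_right (by linarith)
  nlinarith

lemma cut_fderiv (hR : 0 < R) (y : EuclideanSpace ℝ (Fin n)) (i : Fin n) :
    |fderiv ℝ (cut x R) y (EuclideanSpace.single i 1)| ≤
      (ball x R).indicator (fun _ => 4 / R) y := by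
  have h1 : HasFDerivAt (fun y : EuclideanSpace ℝ (Fin n) => 1 - ‖y - x‖ ^ 2 / R ^ 2) 
      (-((R ^ 2)⁻¹ • (2 • (innerSL ℝ (y - x))))) y := by
    have h0 : HasFDerivAt (fun y : EuclideanSpace ℝ (Fin n) => y - x) 
      (ContinuousLinearMap.id ℝ _) y := (hasFDerivAt_id y).sub_const x
    have := ((h0.norm_sq).mul_const (R ^ 2)⁻¹).const_sub 1
    simpa [div_eq_mul_inv] using this
  have h2 := (hasDerivAt_posSq (1 - ‖y - x‖ ^ 2 / R ^ 2)).comp_hasFDerivAt y h1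
  have h3 : HasFDerivAt (cut x R) _ y := h2
  rw [h3.fderiv]
  by_cases hy : y ∈ ball x R
  · rw [indicator_of_mem hy]
    rw [mem_ball, dist_eq_norm] at hy
    have hi : |inner ℝ (y - x) (EuclideanSpace.single i (1 : ℝ))| ≤ R := by
      refine (abs_real_inner_le_norm _ _).trans ?_
      simpa using hy.le
    have hm0 : 0 ≤ max 0 (1 - ‖y - x‖ ^ 2 / R ^ 2) := le_max_left _ _
    have hm1 : max 0 (1 - ‖y - x‖ ^ 2 / R ^ 2) ≤ 1 := by
      refine (max_le zero_le_one ?_)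
      have : 0 ≤ ‖y - x‖ ^ 2 / R ^ 2 := by positivity
      linarith
    generalize max 0 (1 - ‖y - x‖ ^ 2 / R ^ 2) = m at *
    have e : (4 : ℝ) / R = 2 * 1 * ((R ^ 2)⁻¹ * (2 * R)) := by field_simp; norm_num
    simp only [ContinuousLinearMap.smul_apply, ContinuousLinearMap.neg_apply, smul_eq_mul,
      innerSL_apply_apply, nsmul_eq_mul, Nat.cast_ofNat, mul_neg, abs_neg, abs_mul, abs_inv, abs_pow]
    rw [abs_of_pos hR, abs_of_nonneg hm0, abs_two, e]
    gcongr
  · rw [indicator_of_notMem hy, cut_eq_zero x hR hy]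
    simp

lemma cut_superlevel (hR : 0 < R) {t : ℝ} (ht : 0 < t) :
    ∃ r ≤ R, {y | t ≤ cut x R y} = closedBall x r := by
  by_cases h1 : t ≤ 1
  · refine ⟨R * √(1 - √t), ?_, ?_⟩
    · have : √(1 - √t) ≤ 1 := by
        rw [Real.sqrt_le_one]
        linarith [Real.sqrt_nonneg t]
      nlinarith
    · ext y
      have hs : √t ≤ 1 := by rwa [Real.sqrt_le_one]
      have hs0 : 0 < √t := Real.sqrt_pos.2 ht
      simp only [mem_setOf_eq, mem_closedBall, dist_eq_norm, cut]
      rw [← Real.sqrt_le_left (le_max_left _ _), le_max_iff, or_iff_right (not_le.2 hs0)]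
      rw [← abs_of_nonneg (norm_nonneg (y - x)), 
        ← abs_of_nonneg (by positivity : 0 ≤ R * √(1 - √t)), ← sq_le_sq, mul_pow,
        Real.sq_sqrt (by linarith), abs_of_nonneg (norm_nonneg (y - x)), mul_comm,
        ← div_le_iff₀ (by positivity)]
      constructor <;> intro h <;> linarith
  · refine ⟨-1, by linarith, ?_⟩
    rw [closedBall_eq_empty.2 (by norm_num)]
    ext y
    simp only [mem_setOf_eq, mem_empty_iff_false, iff_false]
    intro h
    exact h1 (h.trans (cut_le_one x y))

end cutoff

section isoper

/-- Gauss-Green formula for `Ω` with vector measure `ν μ`. -/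
structure GG {n : ℕ} (Ω : Set (EuclideanSpace ℝ (Fin n))) (μ : Measure (EuclideanSpace ℝ (Fin n)))
    (ν : EuclideanSpace ℝ (Fin n) → EuclideanSpace ℝ (Fin n)) : Prop where
  fin : IsFiniteMeasure μ
  meas : Measurable ν
  bdd : ∀ i, ∀ᵐ x ∂μ, |ν x i| ≤ 1
  ne : ∀ᵐ x ∂μ, ν x ≠ 0
  gg : ∀ ψ : EuclideanSpace ℝ (Fin n) → ℝ, ContDiff ℝ 1 ψ → HasCompactSupport ψ → ∀ i,
    ∫ x in Ω, fderiv ℝ ψ x (EuclideanSpace.single i 1) = ∫ x, ψ x * ν x i ∂μ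

lemma integral_fderiv_zero {n : ℕ} {ψ : EuclideanSpace ℝ (Fin n) → ℝ} (hψ : ContDiff ℝ 1 ψ)
    (hc : HasCompactSupport ψ) (v : EuclideanSpace ℝ (Fin n)) : ∫ x, fderiv ℝ ψ x v = 0 := by
  have h := integral_mul_fderiv_eq_neg_fderiv_mul_of_integrable (μ := volume)
    (f := fun _ : EuclideanSpace ℝ (Fin n) => (1 : ℝ)) (g := ψ) (v := v) (by simp)
    (by simpa using integrable_fderiv_apply hψ hc v)
    (by simpa using hψ.continuous.integrable_of_hasCompactSupport hc)
    (fun _ _ => differentiableAt_const _) (fun y _ => hψ.differentiable one_ne_zero y)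
  simpa using h

lemma GG.compl {n : ℕ} {Ω : Set (EuclideanSpace ℝ (Fin n))}
    {μ : Measure (EuclideanSpace ℝ (Fin n))}
    {ν : EuclideanSpace ℝ (Fin n) → EuclideanSpace ℝ (Fin n)} (h : GG Ω μ ν)
    (hm : MeasurableSet Ω) {ψ : EuclideanSpace ℝ (Fin n) → ℝ} (hψ : ContDiff ℝ 1 ψ)
    (hc : HasCompactSupport ψ) (i : Fin n) :
    ∫ x, ψ x * ν x i ∂μ = - ∫ x in Ωᶜ, fderiv ℝ ψ x (EuclideanSpace.single i 1) := by
  rw [← h.gg ψ hψ hc i]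
  have := integral_add_compl hm (integrable_fderiv_apply hψ hc (EuclideanSpace.single i 1))
  rw [integral_fderiv_zero hψ hc] at this
  linarith

theorem isoper {n : ℕ} (hn : 2 ≤ n) : ∃ C : ℝ≥0, ∀ (Ω : Set (EuclideanSpace ℝ (Fin n)))
    (μ : Measure (EuclideanSpace ℝ (Fin n)))
    (ν : EuclideanSpace ℝ (Fin n) → EuclideanSpace ℝ (Fin n)), GG Ω μ ν → MeasurableSet Ω →
    ∀ x R, 0 < R → ENNReal.ofReal (9 / 16) ^ (Real.conjExponent n) * volume (ball x (R / 2) \ Ω) ≤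
      C * (∫⁻ y, ENNReal.ofReal (cut x R y) ∂μ + ENNReal.ofReal (4 / R) * volume (ball x R \ Ω))
        ^ (Real.conjExponent n) := by
  obtain ⟨C, hC⟩ := bv_sobolev hn
  refine ⟨C, fun Ω μ ν h hm x R hR => ?_⟩
  have hfin := h.fin
  have hp0 : 0 ≤ Real.conjExponent n := 
    (Real.HolderConjugate.conjExponent (by exact_mod_cast hn : (1 : ℝ) < n)).symm.pos.le
  have hcc : Continuous (cut x R) := (cut_contDiff x).continuous
  have hci : Integrable (cut x R) μ := hcc.integrable_of_hasCompactSupport (cut_compact x hR)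
  have hmb : MeasurableSet (ball x R \ Ω) := measurableSet_ball.diff hm
  have hvf : volume (ball x R \ Ω) ≠ ⊤ := 
    ((measure_mono diff_subset).trans_lt measure_ball_lt_top).ne
  set κ : Measure (EuclideanSpace ℝ (Fin n)) := 
    μ.withDensity (fun y => ENNReal.ofReal (cut x R y)) + 
      ENNReal.ofReal (4 / R) • volume.restrict (ball x R \ Ω) with hκ
  have hf1 : IsFiniteMeasure (μ.withDensity (fun y => ENNReal.ofReal (cut x R y))) :=
    isFiniteMeasure_withDensity_ofReal hci.2
  have hf2 : IsFiniteMeasure (ENNReal.ofReal (4 / R) • volume.restrict (ball x R \ Ω)) := by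
    refine ⟨?_⟩
    simp only [Measure.smul_apply, Measure.restrict_apply_univ, smul_eq_mul]
    exact ENNReal.mul_lt_top ENNReal.ofReal_lt_top hvf.lt_top
  have hκu : κ univ = ∫⁻ y, ENNReal.ofReal (cut x R y) ∂μ + 
      ENNReal.ofReal (4 / R) * volume (ball x R \ Ω) := by
    simp [hκ, withDensity_apply]
  rw [← hκu]
  have hul : Integrable (Ωᶜ.indicator (cut x R)) :=
    (hcc.integrable_of_hasCompactSupport (cut_compact x hR)).indicator hm.compl
  have hus : HasCompactSupport (Ωᶜ.indicator (cut x R)) := by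
    refine (cut_compact x hR).mono ?_
    intro y hy hy0
    apply hy
    simp [indicator, hy0]
  refine le_trans ?_ (hC (Ωᶜ.indicator (cut x R)) hul.locallyIntegrable hus κ inferInstance ?_)
  · have : ∫⁻ y in ball x (R / 2) \ Ω, ENNReal.ofReal (9 / 16) ^ (Real.conjExponent n) ≤
        ∫⁻ y, ‖Ωᶜ.indicator (cut x R) y‖ₑ ^ (Real.conjExponent n) := by
      refine le_trans (setLIntegral_mono' (measurableSet_ball.diff hm) ?_)
        (setLIntegral_le_lintegral _ _)
      intro y hy
      refine ENNReal.rpow_le_rpow ?_ hp0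
      rw [indicator_of_mem (show y ∈ Ωᶜ from hy.2), ← ofReal_norm, Real.norm_eq_abs,
        abs_of_nonneg (cut_nonneg x y)]
      exact ENNReal.ofReal_le_ofReal (cut_ge x hR hy.1)
    rwa [setLIntegral_const] at this
  · intro ψ hψ hψs i
    set e : EuclideanSpace ℝ (Fin n) := EuclideanSpace.single i 1 with he
    have hψi : ∀ (m : Measure (EuclideanSpace ℝ (Fin n))) [IsFiniteMeasure m],
      Integrable (fun y => |ψ y|) m := fun m _ =>
        (hψ.continuous.integrable_of_hasCompactSupport hψs).abs
    have hprod : ContDiff ℝ 1 (fun y => cut x R y * ψ y) := (cut_contDiff x).mul hψ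
    have hprods : HasCompactSupport (fun y => cut x R y * ψ y) := hψs.mul_left
    have hfd : ∀ y, fderiv ℝ (fun y => cut x R y * ψ y) y e = 
        cut x R y * fderiv ℝ ψ y e + ψ y * fderiv ℝ (cut x R) y e := by
      intro y
      rw [fderiv_fun_mul ((cut_contDiff x).differentiable one_ne_zero y) 
        (hψ.differentiable one_ne_zero y)]
      simp
    have hgg := h.compl hm hprod hprods i
    have hi1 : Integrable (fun y => cut x R y * fderiv ℝ ψ y e) :=
      (hcc.mul ((hψ.continuous_fderiv one_ne_zero).clm_apply
        continuous_const)).integrable_of_hasCompactSupport (cut_compact x hR).mul_right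
    have hi2 : Integrable (fun y => ψ y * fderiv ℝ (cut x R) y e) :=
      (hψ.continuous.mul (((cut_contDiff x).continuous_fderiv one_ne_zero).clm_apply
        continuous_const)).integrable_of_hasCompactSupport hψs.mul_right
    simp only [← he, hfd] at hgg
    rw [integral_add hi1.integrableOn hi2.integrableOn] at hgg
    have hL : ∫ y, Ωᶜ.indicator (cut x R) y * fderiv ℝ ψ y e = 
        ∫ y in Ωᶜ, cut x R y * fderiv ℝ ψ y e := by
      rw [← integral_indicator hm.compl]
      congr 1; ext y
      by_cases hy : y ∈ Ωᶜ <;> simp [hy]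
    have hR1 : ∫ y, |ψ y| ∂κ = ∫ y, cut x R y * |ψ y| ∂μ + 
        (4 / R) * ∫ y in ball x R \ Ω, |ψ y| := by
      rw [hκ, integral_add_measure (hψi _) (hψi _), integral_smul_measure,
        integral_withDensity_eq_integral_toReal_smul (by fun_prop) (by simp)]
      congr 1
      · congr 1; ext y
        rw [ENNReal.toReal_ofReal (cut_nonneg x y), smul_eq_mul]
      · rw [ENNReal.toReal_ofReal (by positivity), smul_eq_mul]
    have hb1 : |∫ y, cut x R y * ψ y * ν y i ∂μ| ≤ ∫ y, cut x R y * |ψ y| ∂μ := by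
      rw [← Real.norm_eq_abs]
      refine norm_integral_le_of_norm_le ?_ ?_
      · exact (hcc.mul hψ.continuous.abs).integrable_of_hasCompactSupport hψs.abs.mul_left
      · filter_upwards [h.bdd i] with y hy
        rw [Real.norm_eq_abs, abs_mul, abs_mul, abs_of_nonneg (cut_nonneg x y)]
        exact mul_le_of_le_one_right (mul_nonneg (cut_nonneg x y) (abs_nonneg _)) hy
    have hb2 : |∫ y in Ωᶜ, ψ y * fderiv ℝ (cut x R) y e| ≤ (4 / R) * ∫ y in ball x R \ Ω, |ψ y| := by
      have e1 : (4 / R) * ∫ y in ball x R \ Ω, |ψ y| = 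
          ∫ y in Ωᶜ, (ball x R).indicator (fun y => (4 / R) * |ψ y|) y := by
        rw [setIntegral_indicator measurableSet_ball, ← integral_const_mul, inter_comm]
        rfl
      rw [e1, ← Real.norm_eq_abs]
      refine norm_integral_le_of_norm_le ?_ ?_
      · exact (((hψ.continuous.integrable_of_hasCompactSupport hψs).abs.const_mul _).indicator 
          measurableSet_ball).integrableOn
      · refine Eventually.of_forall fun y => ?_
        have := cut_fderiv x hR y i
        rw [Real.norm_eq_abs, abs_mul]
        by_cases hy : y ∈ ball x R
        · simp only [hy, indicator_of_mem] at this ⊢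
          rw [mul_comm]
          gcongr
        · simp only [hy, not_false_eq_true, indicator_of_notMem] at this ⊢
          rw [le_antisymm this (abs_nonneg _), mul_zero]
    rw [hL, hR1]
    have : ∫ y in Ωᶜ, cut x R y * fderiv ℝ ψ y e = - ∫ y, cut x R y * ψ y * ν y i ∂μ - 
      ∫ y in Ωᶜ, ψ y * fderiv ℝ (cut x R) y e := by linarith
    rw [this]
    rw [abs_le] at *
    constructor <;> linarith [hb1.1, hb1.2, hb2.1, hb2.2]

end isoper

section lebesguepoints

lemma norm_le_sum_abs {n : ℕ} (v : EuclideanSpace ℝ (Fin n)) : ‖v‖ ≤ ∑ i, |v i| := by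
  have hv : v = ∑ i, v i • (EuclideanSpace.single i (1 : ℝ) : EuclideanSpace ℝ (Fin n)) := by
    ext j
    simp [Finset.sum_apply, Pi.single_apply]
  conv_lhs => rw [hv]
  refine (norm_sum_le _ _).trans (Finset.sum_le_sum fun i _ => ?_)
  rw [norm_smul]
  simp

lemma lebesgue_cut {n : ℕ} {μ : Measure (EuclideanSpace ℝ (Fin n))} [IsFiniteMeasure μ]
    {ν : EuclideanSpace ℝ (Fin n) → EuclideanSpace ℝ (Fin n)} (hν : Measurable ν)
    (hi : Integrable ν μ) : ∀ᵐ x ∂μ, ∀ ε : ℝ≥0, 0 < ε → ∃ r0 > 0, ∀ R, 0 < R → R < r0 →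
      ∫⁻ y, ‖ν y - ν x‖ₑ * ENNReal.ofReal (cut x R y) ∂μ ≤
        ε * ∫⁻ y, ENNReal.ofReal (cut x R y) ∂μ := by
  filter_upwards [(Besicovitch.vitaliFamily μ).ae_tendsto_lintegral_enorm_sub_div
    hi.locallyIntegrable] with x hx ε hε
  have h1 := hx.comp (Besicovitch.tendsto_filterAt μ x)
  have h2 := h1.eventually (gt_mem_nhds (show (0 : ℝ≥0∞) < ε by exact_mod_cast hε))
  obtain ⟨r0, hr0, h3⟩ := mem_nhdsGT_iff_exists_Ioo_subset.1 h2
  refine ⟨r0, hr0, fun R hR hRr => ?_⟩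
  have hmeas : Measurable (fun y => ‖ν y - ν x‖ₑ) := (hν.sub_const _).enorm
  have hball : ∀ r, r < r0 → ∫⁻ y in closedBall x r, ‖ν y - ν x‖ₑ ∂μ ≤ ε * μ (closedBall x r) := by
    intro r hr
    rcases lt_trichotomy r 0 with h | h | h
    · simp [closedBall_eq_empty.2 h]
    · subst h
      simp [closedBall_zero]
    · have h4 : (∫⁻ y in closedBall x r, ‖ν y - ν x‖ₑ ∂μ) / μ (closedBall x r) < ε := h3 ⟨h, hr⟩
      by_cases h0 : μ (closedBall x r) = 0
      · rw [Measure.restrict_eq_zero.2 h0]; simp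
      · exact (ENNReal.div_le_iff h0 (measure_ne_top _ _)).1 h4.le
  have hcc : Continuous (cut x R) := (cut_contDiff x).continuous
  have e1 : ∫⁻ y, ‖ν y - ν x‖ₑ * ENNReal.ofReal (cut x R y) ∂μ = 
      ∫⁻ y, ENNReal.ofReal (cut x R y) ∂(μ.withDensity fun y => ‖ν y - ν x‖ₑ) := by
    rw [lintegral_withDensity_eq_lintegral_mul _ hmeas (by fun_prop)]
    rfl
  rw [e1, lintegral_eq_lintegral_meas_le _ (Eventually.of_forall (cut_nonneg x)) (by fun_prop),
    lintegral_eq_lintegral_meas_le _ (Eventually.of_forall (cut_nonneg x)) (by fun_prop),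
    ← lintegral_const_mul' _ _ ENNReal.coe_ne_top]
  refine setLIntegral_mono' measurableSet_Ioi fun t ht => ?_
  obtain ⟨r, hr, hs⟩ := cut_superlevel x hR ht
  rw [hs, withDensity_apply _ measurableSet_closedBall]
  exact hball r (hr.trans_lt hRr)

theorem GG.lebesgue {n : ℕ} {Ω : Set (EuclideanSpace ℝ (Fin n))}
    {μ : Measure (EuclideanSpace ℝ (Fin n))}
    {ν : EuclideanSpace ℝ (Fin n) → EuclideanSpace ℝ (Fin n)} (h : GG Ω μ ν)
    (hm : MeasurableSet Ω) : ∀ᵐ x ∂μ, ∃ K > 0, ∃ r0 > 0, ∀ R, 0 < R → R < r0 →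
      ∫⁻ y, ENNReal.ofReal (cut x R y) ∂μ ≤ ENNReal.ofReal (K / R) * volume (ball x R \ Ω) := by
  have hfin := h.fin
  have hmi : ∀ i, Measurable fun y => ν y i := fun i => by
    have := h.meas
    fun_prop
  have hi : Integrable ν μ := by
    refine Integrable.of_bound h.meas.aestronglyMeasurable (n : ℝ) ?_
    filter_upwards [ae_all_iff.2 h.bdd] with y hy
    refine (norm_le_sum_abs _).trans ((Finset.sum_le_sum fun i _ => hy i).trans ?_)
    simp
  filter_upwards [h.ne, lebesgue_cut h.meas hi] with x hx hl
  set v := ν x with hv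
  have hv0 : 0 < ‖v‖ := norm_pos_iff.2 hx
  obtain ⟨r0, hr0, h1⟩ := hl (‖v‖₊ / 2) (half_pos (nnnorm_pos.2 hx))
  have hn0 : 0 < n := by
    rcases Nat.eq_zero_or_pos n with h0 | h0
    · subst h0; exact absurd (Subsingleton.elim v 0) hx
    · exact h0
  refine ⟨8 * n / ‖v‖, by positivity, r0, hr0, fun R hR hRr => ?_⟩
  have hcc : Continuous (cut x R) := (cut_contDiff x).continuous
  have hci : Integrable (cut x R) μ := hcc.integrable_of_hasCompactSupport (cut_compact x hR)
  have hvf : volume (ball x R \ Ω) ≠ ⊤ := 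
    ((measure_mono diff_subset).trans_lt measure_ball_lt_top).ne
  set M := (volume (ball x R \ Ω)).toReal with hM
  set I := ∫ y, cut x R y ∂μ with hI
  have hIe : ∫⁻ y, ENNReal.ofReal (cut x R y) ∂μ = ENNReal.ofReal I :=
    (ofReal_integral_eq_lintegral_ofReal hci (Eventually.of_forall (cut_nonneg x))).symm
  have hI0 : 0 ≤ I := integral_nonneg (cut_nonneg x)
  have hdi : Integrable (fun y => ‖ν y - v‖ * cut x R y) μ := by
    refine ((hi.sub (integrable_const v)).norm).mul_bdd (c := 1) hcc.aestronglyMeasurable ?_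
    refine Eventually.of_forall fun y => ?_
    rw [Real.norm_eq_abs, abs_of_nonneg (cut_nonneg x y)]
    exact cut_le_one x y
  have h2 : ∫ y, ‖ν y - v‖ * cut x R y ∂μ ≤ ‖v‖ / 2 * I := by
    have h3 := h1 R hR hRr
    rw [hIe] at h3
    have e : ∫⁻ y, ‖ν y - v‖ₑ * ENNReal.ofReal (cut x R y) ∂μ = 
        ENNReal.ofReal (∫ y, ‖ν y - v‖ * cut x R y ∂μ) := by
      rw [ofReal_integral_eq_lintegral_ofReal hdi (Eventually.of_forall fun y => 
        mul_nonneg (norm_nonneg _) (cut_nonneg x y))]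
      refine lintegral_congr fun y => ?_
      rw [ENNReal.ofReal_mul (norm_nonneg _), ofReal_norm]
    rw [e] at h3
    have e2 : ((‖v‖₊ / 2 : ℝ≥0) : ℝ≥0∞) = ENNReal.ofReal (‖v‖ / 2) := by
      rw [← ENNReal.ofReal_coe_nnreal]; simp
    rw [e2, ← ENNReal.ofReal_mul (by positivity)] at h3
    exact (ENNReal.ofReal_le_ofReal_iff (by positivity)).1 h3
  have hci2 : ∀ i, Integrable (fun y => cut x R y * ν y i) μ := by
    intro i
    refine hci.mul_bdd (c := 1) (hmi i).aestronglyMeasurable ?_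
    simpa using h.bdd i
  have h4 : ∫ y, (‖v‖ ^ 2 * cut x R y - ‖v‖ * (‖ν y - v‖ * cut x R y)) ∂μ ≤ 
      ∑ i, v i * ∫ y, cut x R y * ν y i ∂μ := by
    simp_rw [← integral_const_mul]
    rw [← integral_finsetSum _ fun i _ => (hci2 i).const_mul _]
    refine integral_mono ((hci.const_mul _).sub (hdi.const_mul _)) 
      (integrable_finsetSum _ fun i _ => (hci2 i).const_mul _) fun y => ?_
    have e3 : ∑ i, v i * (cut x R y * ν y i) = cut x R y * inner ℝ v (ν y) := by
      rw [PiLp.inner_apply, Finset.mul_sum]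
      refine Finset.sum_congr rfl fun i _ => ?_
      simp; ring
    have e4 : inner ℝ v (ν y) = ‖v‖ ^ 2 + inner ℝ v (ν y - v) := by
      rw [inner_sub_right, real_inner_self_eq_norm_sq]; ring
    have e5 := abs_le.1 (abs_real_inner_le_norm v (ν y - v))
    simp only [e3]
    rw [e4]
    nlinarith [mul_le_mul_of_nonneg_left e5.1 (cut_nonneg (R := R) x y)]
  rw [integral_sub (hci.const_mul _) (hdi.const_mul _), integral_const_mul, integral_const_mul] at h4
  have h5 : ∀ i, v i * ∫ y, cut x R y * ν y i ∂μ ≤ ‖v‖ * (4 / R * M) := by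
    intro i
    rw [h.compl hm (cut_contDiff x) (cut_compact x hR) i]
    have h6 : |∫ y in Ωᶜ, fderiv ℝ (cut x R) y (EuclideanSpace.single i 1)| ≤ 4 / R * M := by
      have e6 : 4 / R * M = ∫ y in Ωᶜ, (ball x R).indicator (fun _ => 4 / R) y := by
        rw [setIntegral_indicator measurableSet_ball, setIntegral_const, inter_comm, mul_comm]
        rfl
      rw [e6, ← Real.norm_eq_abs]
      refine norm_integral_le_of_norm_le ?_ (Eventually.of_forall fun y => cut_fderiv x hR y i)
      refine Integrable.integrableOn ?_
      rw [integrable_indicator_iff measurableSet_ball]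
      exact integrableOn_const measure_ball_lt_top.ne
    refine (le_abs_self _).trans ?_
    rw [abs_mul, abs_neg]
    exact mul_le_mul (PiLp.norm_apply_le v i) h6 (abs_nonneg _) (norm_nonneg _)
  have h7 : ∑ i, v i * ∫ y, cut x R y * ν y i ∂μ ≤ n * (‖v‖ * (4 / R * M)) := by
    refine (Finset.sum_le_sum fun i _ => h5 i).trans ?_
    simp
  have h8 : ‖v‖ ^ 2 / 2 * I ≤ n * (‖v‖ * (4 / R * M)) := by
    have := mul_le_mul_of_nonneg_left h2 hv0.le
    nlinarith
  have h9 : I ≤ 8 * n / ‖v‖ / R * M := by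
    have e7 : 8 * n / ‖v‖ / R * M = (n * (‖v‖ * (4 / R * M))) / (‖v‖ ^ 2 / 2) := by
      field_simp; ring
    rw [e7, le_div_iff₀ (by positivity)]
    linarith
  rw [hIe, ← ENNReal.ofReal_toReal hvf, ← ENNReal.ofReal_mul (by positivity)]
  exact ENNReal.ofReal_le_ofReal h9

end lebesguepoints

section scales

lemma scale_select {n : ℕ} {g : ℝ → ℝ} (hg : Monotone g) {a δ : ℝ} (hδ : 0 < δ)
    (hδa : δ * 2 ^ n ≤ a)
    (h1 : ∀ r > 0, ∃ R, 0 < R ∧ R < r ∧ a * R ^ n ≤ g R)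
    (h2 : ∀ r > 0, ∃ R, 0 < R ∧ R < r ∧ g R < δ * R ^ n) {r : ℝ} (hr : 0 < r) :
    ∃ R, 0 < R ∧ R < r ∧ g R < δ * R ^ n ∧ δ * (R / 2) ^ n ≤ g (R / 2) := by
  by_contra! hcon
  obtain ⟨R0, hR0, hR0r, hg0⟩ := h2 r hr
  have hk : ∀ k : ℕ, g (R0 * (1 / 2) ^ k) < δ * (R0 * (1 / 2) ^ k) ^ n := by
    intro k
    induction k with
    | zero => simpa using hg0
    | succ k ih =>
      have := hcon (R0 * (1 / 2) ^ k) (by positivity) (lt_of_le_of_lt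
        (mul_le_of_le_one_right hR0.le (pow_le_one₀ (by norm_num) (by norm_num))) hR0r) ih
      have e : R0 * (1 / 2) ^ k / 2 = R0 * (1 / 2) ^ (k + 1) := by ring
      rwa [e] at this
  obtain ⟨R1, hR1, hR1r, hg1⟩ := h1 R0 hR0
  obtain ⟨k, hk1, hk2⟩ := exists_nat_pow_near_of_lt_one (x := R1 / R0) (y := (1 / 2 : ℝ))
    (by positivity) ((div_le_one hR0).2 hR1r.le) (by norm_num) (by norm_num)
  rw [lt_div_iff₀ hR0] at hk1
  rw [div_le_iff₀ hR0] at hk2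
  have h3 : g R1 ≤ g (R0 * (1 / 2) ^ k) := hg (by linarith)
  have h4 : R0 * (1 / 2) ^ k ≤ 2 * R1 := by
    rw [pow_succ] at hk1; linarith
  have h5 : δ * (R0 * (1 / 2) ^ k) ^ n ≤ δ * (2 * R1) ^ n := by gcongr
  have h6 : δ * (2 * R1) ^ n ≤ a * R1 ^ n := by
    rw [mul_pow, ← mul_assoc]; gcongr
  linarith [hk k]

lemma small_delta {c q : ℝ} (hc : 0 < c) (hq : q < 1) (K : ℝ) :
    ∀ᶠ δ in 𝓝[>] (0 : ℝ), K * δ < c * δ ^ q := by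
  have h1 : Tendsto (fun δ : ℝ => K * δ ^ (1 - q)) (𝓝[>] 0) (𝓝 0) := by
    have : Tendsto (fun δ : ℝ => K * δ ^ (1 - q)) (𝓝 0) (𝓝 (K * 0 ^ (1 - q))) :=
      ((Real.continuousAt_rpow_const 0 (1 - q) (Or.inr (by linarith))).tendsto).const_mul K
    rw [Real.zero_rpow (by linarith), mul_zero] at this
    exact this.mono_left nhdsWithin_le_nhds
  filter_upwards [h1.eventually (gt_mem_nhds hc), self_mem_nhdsWithin] with δ h hδ
  have hδ' : 0 < δ := hδ
  have e : δ = δ ^ (1 - q) * δ ^ q := by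
    rw [← Real.rpow_add hδ']; simp
  calc K * δ = K * δ ^ (1 - q) * δ ^ q := by rw [mul_assoc, ← e]
    _ < c * δ ^ q := by gcongr

/-- The volume of the complement of `Ω` in balls. -/
def gfun {n : ℕ} (Ω : Set (EuclideanSpace ℝ (Fin n))) (x : EuclideanSpace ℝ (Fin n)) (R : ℝ) : ℝ :=
  (volume (ball x R \ Ω)).toReal

lemma gfun_ne_top {n : ℕ} (Ω : Set (EuclideanSpace ℝ (Fin n))) (x : EuclideanSpace ℝ (Fin n))
    (R : ℝ) : volume (ball x R \ Ω) ≠ ⊤ :=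
  ((measure_mono diff_subset).trans_lt measure_ball_lt_top).ne

lemma gfun_mono {n : ℕ} (Ω : Set (EuclideanSpace ℝ (Fin n))) (x : EuclideanSpace ℝ (Fin n)) :
    Monotone (gfun Ω x) := fun r s hrs =>
  ENNReal.toReal_mono (gfun_ne_top _ _ _) (measure_mono (diff_subset_diff_left (ball_subset_ball hrs)))

theorem isoper_real {n : ℕ} (hn : 2 ≤ n) : ∃ c > 0, ∀ (Ω : Set (EuclideanSpace ℝ (Fin n)))
    (μ : Measure (EuclideanSpace ℝ (Fin n)))
    (ν : EuclideanSpace ℝ (Fin n) → EuclideanSpace ℝ (Fin n)), GG Ω μ ν → MeasurableSet Ω →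
    ∀ x R δ, 0 < R → 0 < δ → gfun Ω x R < δ * R ^ n → δ * (R / 2) ^ n ≤ gfun Ω x (R / 2) →
      c * δ ^ (1 / Real.conjExponent n) * R ^ (n - 1) ≤
        (∫⁻ y, ENNReal.ofReal (cut x R y) ∂μ).toReal + 4 * δ * R ^ (n - 1) := by
  obtain ⟨C, hC⟩ := isoper hn
  have hconj := (Real.HolderConjugate.conjExponent (by exact_mod_cast hn : (1 : ℝ) < n))
  set p := Real.conjExponent n with hpdef
  have hp : 0 < p := hconj.symm.pos
  have hpn : ((n - 1 : ℕ) : ℝ) * p = n := by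
    rw [hpdef, Real.conjExponent, Nat.cast_sub (by omega)]
    have : (n : ℝ) - 1 ≠ 0 := by
      have : (2 : ℝ) ≤ n := by exact_mod_cast hn
      linarith
    field_simp
    push_cast; ring
  refine ⟨(((9 / 16 : ℝ) ^ p / 2 ^ n) / (C + 1)) ^ (1 / p), by positivity, ?_⟩
  intro Ω μ ν h hm x R δ hR hδ h1 h2
  have hfin := h.fin
  have hci : Integrable (cut x R) μ := 
    (cut_contDiff x).continuous.integrable_of_hasCompactSupport (cut_compact x hR)
  set A := (∫⁻ y, ENNReal.ofReal (cut x R y) ∂μ).toReal with hA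
  have hAt : ∫⁻ y, ENNReal.ofReal (cut x R y) ∂μ ≠ ⊤ := hci.lintegral_lt_top.ne
  have hA0 : 0 ≤ A := ENNReal.toReal_nonneg
  have hg0 : 0 ≤ gfun Ω x R := ENNReal.toReal_nonneg
  have h3 := hC Ω μ ν h hm x R hR
  have h4 : (9 / 16 : ℝ) ^ p * gfun Ω x (R / 2) ≤ C * (A + 4 / R * gfun Ω x R) ^ p := by
    have h5 := ENNReal.toReal_mono ?_ h3
    · rw [ENNReal.toReal_mul, ENNReal.toReal_mul, ← ENNReal.toReal_rpow, ← ENNReal.toReal_rpow,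
        ENNReal.toReal_add hAt (ENNReal.mul_ne_top ENNReal.ofReal_ne_top (gfun_ne_top _ _ _)),
        ENNReal.toReal_mul, ENNReal.toReal_ofReal (by positivity),
        ENNReal.toReal_ofReal (by positivity)] at h5
      exact h5
    · refine ENNReal.mul_ne_top ENNReal.coe_ne_top (ENNReal.rpow_ne_top_of_nonneg hp.le ?_)
      exact ENNReal.add_ne_top.2 ⟨hAt, ENNReal.mul_ne_top ENNReal.ofReal_ne_top (gfun_ne_top _ _ _)⟩
  have hRn : R ^ n = R * R ^ (n - 1) := by
    rw [← pow_succ']; congr 1; omega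
  have h6 : A + 4 / R * gfun Ω x R ≤ A + 4 * δ * R ^ (n - 1) := by
    have : 4 / R * gfun Ω x R ≤ 4 / R * (δ * R ^ n) := by gcongr
    have e : 4 / R * (δ * R ^ n) = 4 * δ * R ^ (n - 1) := by
      rw [hRn]; field_simp
    linarith
  set B := A + 4 * δ * R ^ (n - 1) with hB
  have hB0 : 0 ≤ B := by positivity
  have h7 : (9 / 16 : ℝ) ^ p * (δ * (R / 2) ^ n) ≤ (C + 1) * B ^ p := by
    calc (9 / 16 : ℝ) ^ p * (δ * (R / 2) ^ n) ≤ (9 / 16 : ℝ) ^ p * gfun Ω x (R / 2) := by gcongr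
      _ ≤ C * (A + 4 / R * gfun Ω x R) ^ p := h4
      _ ≤ C * B ^ p := by gcongr
      _ ≤ (C + 1) * B ^ p := by gcongr; linarith
  have h8 : ((9 / 16 : ℝ) ^ p / 2 ^ n) / (C + 1) * δ * R ^ n ≤ B ^ p := by
    have e : ((9 / 16 : ℝ) ^ p / 2 ^ n) / (C + 1) * δ * R ^ n = 
      ((9 / 16 : ℝ) ^ p * (δ * (R / 2) ^ n)) / (C + 1) := by
        rw [div_pow]; field_simp
    rw [e, div_le_iff₀ (by positivity)]
    linarith
  have h9 := Real.rpow_le_rpow (by positivity) h8 (by positivity : 0 ≤ 1 / p)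
  rw [← Real.rpow_mul hB0, mul_one_div_cancel hp.ne', Real.rpow_one,
    Real.mul_rpow (by positivity) (by positivity), Real.mul_rpow (by positivity) (by positivity)] at h9
  have e2 : (R ^ n) ^ (1 / p) = R ^ (n - 1) := by
    rw [← Real.rpow_natCast R n, ← Real.rpow_mul hR.le, ← Real.rpow_natCast R (n - 1)]
    congr 1
    rw [← hpn]; field_simp
  rwa [e2] at h9

/-- Points where the complement has upper density at least `a` and lower density zero. -/
def badSet {n : ℕ} (Ω : Set (EuclideanSpace ℝ (Fin n))) (a : ℝ) : Set (EuclideanSpace ℝ (Fin n)) :=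
  {x | (∀ r > 0, ∃ R, 0 < R ∧ R < r ∧ a * R ^ n ≤ gfun Ω x R) ∧
    ∀ δ > 0, ∀ r > 0, ∃ R, 0 < R ∧ R < r ∧ gfun Ω x R < δ * R ^ n}

lemma badSet_null {n : ℕ} (hn : 2 ≤ n) {Ω : Set (EuclideanSpace ℝ (Fin n))}
    {μ : Measure (EuclideanSpace ℝ (Fin n))}
    {ν : EuclideanSpace ℝ (Fin n) → EuclideanSpace ℝ (Fin n)} (h : GG Ω μ ν)
    (hm : MeasurableSet Ω) {a : ℝ} (ha : 0 < a) : μ (badSet Ω a) = 0 := by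
  obtain ⟨c, hc, hiso⟩ := isoper_real hn
  have hconj := (Real.HolderConjugate.conjExponent (by exact_mod_cast hn : (1 : ℝ) < n))
  have hq : 1 / Real.conjExponent n < 1 := by
    rw [div_lt_one hconj.symm.pos]; exact hconj.symm.lt
  have hae : ∀ᵐ x ∂μ, x ∉ badSet Ω a := by
    filter_upwards [h.lebesgue hm] with x ⟨K, hK, r0, hr0, hL⟩ hx
    obtain ⟨δ, ⟨hδ1, hδ2⟩, hδ⟩ := (((small_delta hc hq (4 + K)).and 
      (nhdsWithin_le_nhds (gt_mem_nhds (by positivity : 0 < a / 2 ^ n)))).and 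
      (self_mem_nhdsWithin (a := (0 : ℝ)) (s := Ioi 0))).exists
    have hδ0 : 0 < δ := hδ
    obtain ⟨R, hR, hRr, h1, h2⟩ := scale_select (gfun_mono Ω x) hδ0 
      ((le_div_iff₀ (by positivity)).1 hδ2.le) hx.1 (hx.2 δ hδ0) hr0
    have h3 := hiso Ω μ ν h hm x R δ hR hδ0 h1 h2
    have h4 := ENNReal.toReal_mono 
      (ENNReal.mul_ne_top ENNReal.ofReal_ne_top (gfun_ne_top _ _ _)) (hL R hR hRr)
    rw [ENNReal.toReal_mul, ENNReal.toReal_ofReal (by positivity)] at h4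
    change _ ≤ K / R * gfun Ω x R at h4
    have hRn : R ^ n = R * R ^ (n - 1) := by
      rw [← pow_succ']; congr 1; omega
    have h5 : K / R * gfun Ω x R ≤ K * δ * R ^ (n - 1) := by
      have : K / R * gfun Ω x R ≤ K / R * (δ * R ^ n) := by gcongr
      have e : K / R * (δ * R ^ n) = K * δ * R ^ (n - 1) := by
        rw [hRn]; field_simp
      linarith
    have h6 : (4 + K) * δ * R ^ (n - 1) < c * δ ^ (1 / Real.conjExponent n) * R ^ (n - 1) := by
      gcongr
    linarith
  simpa [ae_iff] using hae

lemma badSet_dense {n : ℕ} (hn : 2 ≤ n) {Ω : Set (EuclideanSpace ℝ (Fin n))}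
    {μ : Measure (EuclideanSpace ℝ (Fin n))}
    {ν : EuclideanSpace ℝ (Fin n) → EuclideanSpace ℝ (Fin n)} (h : GG Ω μ ν)
    (hm : MeasurableSet Ω) {a : ℝ} (ha : 0 < a) : ∃ τ > 0, ∀ x ∈ badSet Ω a, ∀ r > 0, 
    ∃ R, 0 < R ∧ R < r ∧ ENNReal.ofReal (τ * R ^ (n - 1)) ≤ μ (closedBall x R) := by
  obtain ⟨c, hc, hiso⟩ := isoper_real hn
  have hfin := h.fin
  have hconj := (Real.HolderConjugate.conjExponent (by exact_mod_cast hn : (1 : ℝ) < n))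
  have hq : 1 / Real.conjExponent n < 1 := by
    rw [div_lt_one hconj.symm.pos]; exact hconj.symm.lt
  obtain ⟨δ, ⟨hδ1, hδ2⟩, hδ⟩ := (((small_delta hc hq 5).and 
      (nhdsWithin_le_nhds (gt_mem_nhds (by positivity : 0 < a / 2 ^ n)))).and 
      (self_mem_nhdsWithin (a := (0 : ℝ)) (s := Ioi 0))).exists
  have hδ0 : 0 < δ := hδ
  refine ⟨δ, hδ0, fun x hx r hr => ?_⟩
  obtain ⟨R, hR, hRr, h1, h2⟩ := scale_select (gfun_mono Ω x) hδ0 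
      ((le_div_iff₀ (by positivity)).1 hδ2.le) hx.1 (hx.2 δ hδ0) hr
  refine ⟨R, hR, hRr, ?_⟩
  have h3 := hiso Ω μ ν h hm x R δ hR hδ0 h1 h2
  have h6 : 5 * δ * R ^ (n - 1) < c * δ ^ (1 / Real.conjExponent n) * R ^ (n - 1) := by
    gcongr
  have h7 : δ * R ^ (n - 1) ≤ (∫⁻ y, ENNReal.ofReal (cut x R y) ∂μ).toReal := by linarith
  refine (ENNReal.ofReal_le_of_le_toReal h7).trans ?_
  rw [← lintegral_indicator_one measurableSet_closedBall]
  refine lintegral_mono fun y => ?_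
  by_cases hy : y ∈ closedBall x R
  · simp only [hy, indicator_of_mem, Pi.one_apply]
    rw [ENNReal.ofReal_le_one]
    exact cut_le_one x y
  · rw [cut, cut_eq_zero x hR (fun h => hy (ball_subset_closedBall h))]
    simp

end scales

section hausdorff

lemma hausdorff_step {n : ℕ} (hn : 2 ≤ n) {μ : Measure (EuclideanSpace ℝ (Fin n))}
    [IsFiniteMeasure μ] {N : Set (EuclideanSpace ℝ (Fin n))} (hN : μ N = 0) {τ : ℝ} (hτ : 0 < τ)
    (h : ∀ x ∈ N, ∀ r > 0, 
      ∃ R, 0 < R ∧ R < r ∧ ENNReal.ofReal (τ * R ^ (n - 1)) ≤ μ (closedBall x R))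
    {ε : ℝ} (hε : 0 < ε) :
    ∃ (u : Set (EuclideanSpace ℝ (Fin n))) (t : u → Set (EuclideanSpace ℝ (Fin n))),
      u.Countable ∧ (∀ i, ediam (t i) ≤ ENNReal.ofReal (10 * ε)) ∧ N ⊆ ⋃ i, t i ∧
      ∑' i, ediam (t i) ^ ((n : ℝ) - 1) ≤ ENNReal.ofReal (10 ^ (n - 1) / τ) * ENNReal.ofReal ε := by
  obtain ⟨U, hNU, hUo, hU⟩ := N.exists_isOpen_lt_of_lt (μ := μ) (ENNReal.ofReal ε)
    (by rw [hN]; exact ENNReal.ofReal_pos.2 hε)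
  have hex : ∀ x : EuclideanSpace ℝ (Fin n), ∃ R, x ∈ N → 0 < R ∧ R ≤ ε ∧ closedBall x R ⊆ U ∧
      ENNReal.ofReal (τ * R ^ (n - 1)) ≤ μ (closedBall x R) := by
    intro x
    by_cases hx : x ∈ N
    · obtain ⟨s, hs, hsU⟩ := Metric.isOpen_iff.1 hUo x (hNU hx)
      obtain ⟨R, hR, hRr, hRm⟩ := h x hx (min s ε) (lt_min hs hε)
      exact ⟨R, fun _ => ⟨hR, (hRr.trans_le (min_le_right _ _)).le, 
        (closedBall_subset_ball (hRr.trans_le (min_le_left _ _))).trans hsU, hRm⟩⟩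
    · exact ⟨0, fun h => absurd h hx⟩
  choose ρ hρ using hex
  obtain ⟨u, huN, hud, hucov⟩ := Vitali.exists_disjoint_subfamily_covering_enlargement_closedBall
    N (fun x => x) ρ ε (fun a ha => (hρ a ha).2.1) 5 (by norm_num)
  have huc : u.Countable := hud.countable_of_nonempty_interior fun a ha => by
    have : (ball a (ρ a)).Nonempty := nonempty_ball.2 (hρ a (huN ha)).1
    exact this.mono ball_subset_interior_closedBall
  have hdiam : ∀ b ∈ N, ediam (closedBall b (5 * ρ b)) ≤ ENNReal.ofReal (10 * ρ b) := by
    intro b hb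
    have h0 := (hρ b hb).1
    refine (Metric.ediam_le_of_forall_dist_le fun y hy z hz => ?_).trans_eq rfl
    rw [mem_closedBall] at hy hz
    linarith [dist_triangle_right y z b]
  refine ⟨u, fun b => closedBall b (5 * ρ b), huc, ?_, ?_, ?_⟩
  · intro i
    refine (hdiam _ (huN i.2)).trans (ENNReal.ofReal_le_ofReal ?_)
    linarith [(hρ _ (huN i.2)).2.1]
  · intro y hy
    obtain ⟨b, hb, hsub⟩ := hucov y hy
    exact mem_iUnion.2 ⟨⟨b, hb⟩, hsub (mem_closedBall_self (hρ y hy).1.le)⟩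
  · have := huc.to_subtype
    have hb : ∀ i : u, ediam (closedBall (i : EuclideanSpace ℝ (Fin n)) (5 * ρ i)) ^ ((n : ℝ) - 1) ≤
        ENNReal.ofReal (10 ^ (n - 1) / τ) * μ (closedBall i (ρ i)) := by
      intro i
      have h0 := (hρ _ (huN i.2)).1
      have e : (n : ℝ) - 1 = ((n - 1 : ℕ) : ℝ) := by
        rw [Nat.cast_sub (by omega)]; simp
      rw [e, ENNReal.rpow_natCast]
      calc _ ≤ ENNReal.ofReal (10 * ρ i) ^ (n - 1) := by gcongr; exact hdiam _ (huN i.2)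
        _ = ENNReal.ofReal (10 ^ (n - 1) / τ) * ENNReal.ofReal (τ * ρ i ^ (n - 1)) := by
          rw [← ENNReal.ofReal_pow (by positivity), ← ENNReal.ofReal_mul (by positivity)]
          congr 1
          rw [mul_pow]; field_simp
        _ ≤ _ := by gcongr; exact (hρ _ (huN i.2)).2.2.2
    refine (ENNReal.tsum_le_tsum hb).trans ?_
    rw [ENNReal.tsum_mul_left]
    gcongr
    rw [← measure_iUnion (f := fun i : u => closedBall (i : EuclideanSpace ℝ (Fin n)) (ρ i)) (fun i j hij => hud i.2 j.2 (fun hh => hij (Subtype.ext hh))) 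
      (fun i => measurableSet_closedBall)]
    exact (measure_mono (iUnion_subset fun i => (hρ _ (huN i.2)).2.2.1)).trans hU.le

lemma hausdorff_null {n : ℕ} (hn : 2 ≤ n) {μ : Measure (EuclideanSpace ℝ (Fin n))}
    [IsFiniteMeasure μ] {N : Set (EuclideanSpace ℝ (Fin n))} (hN : μ N = 0) {τ : ℝ} (hτ : 0 < τ)
    (h : ∀ x ∈ N, ∀ r > 0, 
      ∃ R, 0 < R ∧ R < r ∧ ENNReal.ofReal (τ * R ^ (n - 1)) ≤ μ (closedBall x R)) :
    μH[(n : ℝ) - 1] N = 0 := by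
  have hst := fun k : ℕ => hausdorff_step hn hN hτ h (ε := 1 / ((k : ℝ) + 1)) (by positivity)
  choose u t hu hd hc hs using hst
  have hcount : ∀ k, Countable (u k) := fun k => (hu k).to_subtype
  have h0 : Tendsto (fun k : ℕ => 1 / ((k : ℝ) + 1)) atTop (𝓝 0) :=
    tendsto_one_div_add_atTop_nhds_zero_nat
  have h1 : Tendsto (fun k : ℕ => ENNReal.ofReal (10 * (1 / ((k : ℝ) + 1)))) atTop (𝓝 0) := by
    simpa using ENNReal.tendsto_ofReal (h0.const_mul 10)
  have h2 : Tendsto (fun k : ℕ => ENNReal.ofReal (10 ^ (n - 1) / τ) * 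
      ENNReal.ofReal (1 / ((k : ℝ) + 1))) atTop (𝓝 0) := by
    have := ENNReal.Tendsto.const_mul (a := ENNReal.ofReal (10 ^ (n - 1) / τ)) 
      (ENNReal.tendsto_ofReal h0) (Or.inr ENNReal.ofReal_ne_top)
    simpa using this
  have h3 := Measure.hausdorffMeasure_le_liminf_tsum ((n : ℝ) - 1) N _ h1 t
    (Eventually.of_forall hd) (Eventually.of_forall hc)
  refine le_antisymm (h3.trans ?_) zero_le
  rw [← h2.liminf_eq]
  exact liminf_le_liminf (Eventually.of_forall hs)

end hausdorff

section density

lemma density_formula {n : ℕ} (hn : 2 ≤ n) : ∃ w : ℝ, 0 < w ∧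
    ∀ (Ω : Set (EuclideanSpace ℝ (Fin n))), MeasurableSet Ω → ∀ x R, 0 < R →
      volume (Ω ∩ ball x R) / volume (ball x R) = ENNReal.ofReal (1 - gfun Ω x R / R ^ n / w) := by
  have hne : Nonempty (Fin n) := ⟨⟨0, by omega⟩⟩
  have hw0 : volume (ball (0 : EuclideanSpace ℝ (Fin n)) 1) ≠ 0 := (measure_ball_pos _ _ one_pos).ne'
  have hwt : volume (ball (0 : EuclideanSpace ℝ (Fin n)) 1) ≠ ⊤ := measure_ball_lt_top.ne
  refine ⟨(volume (ball (0 : EuclideanSpace ℝ (Fin n)) 1)).toReal, ENNReal.toReal_pos hw0 hwt, ?_⟩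
  intro Ω hm x R hR
  set w := (volume (ball (0 : EuclideanSpace ℝ (Fin n)) 1)).toReal with hw
  have hwp : 0 < w := ENNReal.toReal_pos hw0 hwt
  have hball : (volume (ball x R)).toReal = R ^ n * w := by
    rw [Measure.addHaar_ball_of_pos _ _ hR, ENNReal.toReal_mul, finrank_euclideanSpace_fin,
      ENNReal.toReal_ofReal (by positivity)]
  have hb0 : volume (ball x R) ≠ 0 := (measure_ball_pos _ _ hR).ne'
  have hbt : volume (ball x R) ≠ ⊤ := measure_ball_lt_top.ne
  have hit : volume (Ω ∩ ball x R) ≠ ⊤ := 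
    ((measure_mono inter_subset_right).trans_lt measure_ball_lt_top).ne
  have hsum : (volume (Ω ∩ ball x R)).toReal + gfun Ω x R = R ^ n * w := by
    rw [← hball, gfun, ← ENNReal.toReal_add hit (gfun_ne_top _ _ _), inter_comm,
      measure_inter_add_diff _ hm]
  have hft : volume (Ω ∩ ball x R) / volume (ball x R) ≠ ⊤ := ENNReal.div_ne_top hit hb0
  rw [← ENNReal.ofReal_toReal hft, ENNReal.toReal_div, hball]
  congr 1
  have : (volume (Ω ∩ ball x R)).toReal = R ^ n * w - gfun Ω x R := by linarith
  rw [this]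
  field_simp

lemma lower_of_limsup {n : ℕ} (hn : 2 ≤ n) {Ω : Set (EuclideanSpace ℝ (Fin n))}
    (hm : MeasurableSet Ω) {x : EuclideanSpace ℝ (Fin n)}
    (h : ¬ Filter.limsup (fun r : ℝ => volume (Ω ∩ ball x r) / volume (ball x r)) (𝓝[>] 0) < 1) :
    ∀ δ > 0, ∀ r > 0, ∃ R, 0 < R ∧ R < r ∧ gfun Ω x R < δ * R ^ n := by
  by_contra! hcon
  obtain ⟨δ, hδ, r, hr, hR⟩ := hcon
  obtain ⟨w, hw, hf⟩ := density_formula hn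
  apply h
  have h1 : Filter.limsup (fun r : ℝ => volume (Ω ∩ ball x r) / volume (ball x r)) (𝓝[>] 0) ≤
      ENNReal.ofReal (1 - δ / w) := by
    refine limsup_le_of_le (by isBoundedDefault) ?_
    filter_upwards [Ioo_mem_nhdsGT hr] with R hRR
    rw [hf Ω hm x R hRR.1]
    refine ENNReal.ofReal_le_ofReal ?_
    have h0 : 0 < R := hRR.1
    have h2 : δ ≤ gfun Ω x R / R ^ n := by
      rw [le_div_iff₀ (by positivity)]
      exact hR R hRR.1 hRR.2
    have h3 : δ / w ≤ gfun Ω x R / R ^ n / w := by gcongr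
    linarith
  refine h1.trans_lt ?_
  rw [ENNReal.ofReal_lt_one]
  have : 0 < δ / w := by positivity
  linarith

lemma upper_of_not_density {n : ℕ} (hn : 2 ≤ n) {Ω : Set (EuclideanSpace ℝ (Fin n))}
    (hm : MeasurableSet Ω) {x : EuclideanSpace ℝ (Fin n)} (h : x ∉ densityPts Ω 1) :
    ∃ j : ℕ, ∀ r > 0, ∃ R, 0 < R ∧ R < r ∧ 1 / ((j : ℝ) + 1) * R ^ n ≤ gfun Ω x R := by
  by_contra! hcon
  obtain ⟨w, hw, hf⟩ := density_formula hn
  apply h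
  have h1 : Tendsto (fun R => gfun Ω x R / R ^ n) (𝓝[>] 0) (𝓝 0) := by
    rw [Metric.tendsto_nhds]
    intro ε hε
    obtain ⟨j, hj⟩ := exists_nat_one_div_lt hε
    obtain ⟨r, hr, hR⟩ := hcon j
    filter_upwards [Ioo_mem_nhdsGT hr] with R hRR
    have h0 : 0 < R := hRR.1
    have hg : 0 ≤ gfun Ω x R := ENNReal.toReal_nonneg
    rw [Real.dist_0_eq_abs, abs_of_nonneg (by positivity)]
    refine lt_trans ?_ hj
    rw [div_lt_iff₀ (by positivity)]
    exact hR R hRR.1 hRR.2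
  have h2 : Tendsto (fun R => ENNReal.ofReal (1 - gfun Ω x R / R ^ n / w)) (𝓝[>] 0) (𝓝 1) := by
    have := ENNReal.tendsto_ofReal ((h1.div_const w).const_sub 1)
    simpa using this
  refine Tendsto.congr' ?_ h2
  filter_upwards [self_mem_nhdsWithin] with R hR
  exact (hf Ω hm x R hR).symm

end density

/-- For a bounded set of finite perimeter `Ω ⊆ ℝⁿ` (`n ≥ 2`),
`H^{n-1}(∂Ω ∩ Ω¹) = 0` iff for `H^{n-1}`-a.e. `x ∈ ∂Ω` one has
`limsup_{r→0} |Ω ∩ B_r(x)| / |B_r(x)| < 1`. -/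
theorem null_interior_boundary_iff_density_lt_one (n : ℕ) (hn : 2 ≤ n)
    (Ω : Set (EuclideanSpace ℝ (Fin n)))
    (hb : Bornology.IsBounded Ω) (hm : MeasurableSet Ω) (hper : perimeter Ω ≠ ⊤) :
    μH[(n : ℝ) - 1] (frontier Ω ∩ densityPts Ω 1) = 0 ↔
      ∀ᵐ x ∂(μH[(n : ℝ) - 1].restrict (frontier Ω)),
        Filter.limsup (fun r : ℝ => volume (Ω ∩ ball x r) / volume (ball x r))
          (𝓝[>] 0) < 1 := by
  obtain ⟨μ, ν, hfin, hν, hbd, hne, hgg⟩ := gauss_green hper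
  have h : GG Ω μ ν := ⟨hfin, hν, hbd, hne, hgg⟩
  rw [ae_restrict_iff' isClosed_frontier.measurableSet, ae_iff]
  constructor
  · intro h0
    have hbad : ∀ j : ℕ, μH[(n : ℝ) - 1] (badSet Ω (1 / ((j : ℝ) + 1))) = 0 := by
      intro j
      have hj : 0 < 1 / ((j : ℝ) + 1) := by positivity
      obtain ⟨τ, hτ, hd⟩ := badSet_dense hn h hm hj
      exact hausdorff_null hn (badSet_null hn h hm hj) hτ hd
    refine measure_mono_null ?_ (measure_union_null h0 (measure_iUnion_null hbad))
    intro x hx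
    have hx' : ¬(x ∈ frontier Ω → Filter.limsup
      (fun r : ℝ => volume (Ω ∩ ball x r) / volume (ball x r)) (𝓝[>] 0) < 1) := hx
    push Not at hx'
    by_cases h1 : x ∈ densityPts Ω 1
    · exact Or.inl ⟨hx'.1, h1⟩
    · obtain ⟨j, hj⟩ := upper_of_not_density hn hm h1
      exact Or.inr (mem_iUnion.2 ⟨j, hj, lower_of_limsup hn hm (not_lt.2 hx'.2)⟩)
  · intro h0
    refine measure_mono_null ?_ h0
    intro x hx
    have hx' : ¬(x ∈ frontier Ω → Filter.limsup
      (fun r : ℝ => volume (Ω ∩ ball x r) / volume (ball x r)) (𝓝[>] 0) < 1) := by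
      intro hc
      have h2 : Tendsto (fun r : ℝ => volume (Ω ∩ ball x r) / volume (ball x r)) (𝓝[>] 0) (𝓝 1) :=
        hx.2
      have := hc hx.1
      rw [h2.limsup_eq] at this
      exact lt_irrefl _ this
    exact hx'
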